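/- arXiv:1102.0031 — 2 statements merged into one kernel-verified Lean document; each statement's English description precedes it below -/
import Mathlib

section
/- Let G be a countable group generated by subgroups X₁, …, X_k, let H be a subgroup of the center Z(G), and let m ≥ 1 be an integer such that every irreducible unitary representation of G on which H acts nontrivially has Hilbert dimension at least m. Let X̄ᵢ denote the image of Xᵢ in G/H, and suppose ε ∈ [0, 1] is such that for every unitary representation W of G/H with no nonzero invariant vectors and all wᵢ ∈ W^{X̄ᵢ}, one has ‖w₁ + ⋯ + w_k‖² ≤ (1 − ε)·k·(‖w₁‖² + ⋯ + ‖w_k‖²). Then for every unitary representation V of G with no nonzero G-invariant vectors and all vᵢ ∈ V^{Xᵢ}, one has ‖v₁ + ⋯ + v_k‖² ≤ (1 − (m−1)ε/(2m))·k·(‖v₁‖² + ⋯ + ‖v_k‖²); that is, codist(X₁, …, X_k) ≤ 1 − (m−1)ε/(2m). -/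
universe u

theorem aux_mul {G W : Type*} [Group G] [NormedAddCommGroup W] [InnerProductSpace ℂ W]
    (ρ : G →* (W ≃ₗᵢ[ℂ] W)) (g h : G) (w : W) : ρ (g * h) w = ρ g (ρ h w) := by
  rw [map_mul]; rfl

theorem aux_one {G W : Type*} [Group G] [NormedAddCommGroup W] [InnerProductSpace ℂ W]
    (ρ : G →* (W ≃ₗᵢ[ℂ] W)) (w : W) : ρ 1 w = w := by
  rw [map_one]; rfl

theorem aux_inv {G W : Type*} [Group G] [NormedAddCommGroup W] [InnerProductSpace ℂ W]
    (ρ : G →* (W ≃ₗᵢ[ℂ] W)) (g : G) (w : W) : ρ g (ρ g⁻¹ w) = w := by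
  rw [← aux_mul, mul_inv_cancel, aux_one]

theorem aux_inv' {G W : Type*} [Group G] [NormedAddCommGroup W] [InnerProductSpace ℂ W]
    (ρ : G →* (W ≃ₗᵢ[ℂ] W)) (g : G) (w : W) : ρ g⁻¹ (ρ g w) = w := by
  rw [← aux_mul, inv_mul_cancel, aux_one]

theorem aux_adj {G W : Type*} [Group G] [NormedAddCommGroup W] [InnerProductSpace ℂ W]
    (ρ : G →* (W ≃ₗᵢ[ℂ] W)) (g : G) (x y : W) : inner ℂ (ρ g x) y = inner ℂ x (ρ g⁻¹ y) := by
  rw [← (ρ g).inner_map_map x, aux_inv]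

theorem aux_adj' {G W : Type*} [Group G] [NormedAddCommGroup W] [InnerProductSpace ℂ W]
    (ρ : G →* (W ≃ₗᵢ[ℂ] W)) (g : G) (x y : W) : inner ℂ x (ρ g y) = inner ℂ (ρ g⁻¹ x) y := by
  rw [aux_adj, inv_inv]

theorem aux_rep_extend {G : Type*} [Group G] {E W : Type*} [AddCommGroup E] [Module ℂ E]
    [NormedAddCommGroup W] [InnerProductSpace ℂ W] [CompleteSpace W]
    (e : E →ₗ[ℂ] W) (he : DenseRange e) (a : G → E ≃ₗ[ℂ] E)
    (hmul : ∀ g h x, a (g * h) x = a g (a h x))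
    (hnorm : ∀ g x, ‖e (a g x)‖ = ‖e x‖) :
    ∃ ρ : G →* (W ≃ₗᵢ[ℂ] W), ∀ g x, ρ g (e x) = e (a g x) := by
  have key : ∀ g x, (LinearEquiv.extendOfIsometry (a g) e e he he (hnorm g)) (e x) = e (a g x) := by
    intro g x
    rw [LinearEquiv.extendOfIsometry_apply]
    exact LinearMap.extendOfNorm_eq he ⟨1, fun y => by simp [hnorm]⟩ x
  refine ⟨MonoidHom.mk' (fun g => LinearEquiv.extendOfIsometry (a g) e e he he (hnorm g)) ?_, ?_⟩
  · intro g h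
    ext w
    refine he.induction_on (p := fun w => (LinearEquiv.extendOfIsometry (a (g*h)) e e he he (hnorm (g*h))) w
      = ((LinearEquiv.extendOfIsometry (a g) e e he he (hnorm g)) *
        (LinearEquiv.extendOfIsometry (a h) e e he he (hnorm h))) w) w ?_ ?_
    · exact isClosed_eq (LinearIsometryEquiv.continuous _) (LinearIsometryEquiv.continuous _)
    · intro x
      change _ = (LinearEquiv.extendOfIsometry (a g) e e he he (hnorm g)) ((LinearEquiv.extendOfIsometry (a h) e e he he (hnorm h)) (e x))
      rw [key, key, key, hmul]
  · intro g x
    exact key g x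

theorem aux_gns {S : Type u} (N : S → S → ℂ) (herm : ∀ s t, N t s = starRingEnd ℂ (N s t))
    (psd : ∀ f : S →₀ ℂ, 0 ≤ (f.sum fun s a => f.sum fun t b => starRingEnd ℂ a * b * N s t).re) :
    ∃ (W : Type u) (_ : NormedAddCommGroup W) (_ : InnerProductSpace ℂ W) (_ : CompleteSpace W)
      (ξ : S → W), (∀ s t, inner ℂ (ξ s) (ξ t) = N s t) ∧
        DenseRange (Finsupp.linearCombination ℂ ξ) := by
  let core : PreInnerProductSpace.Core ℂ (S →₀ ℂ) :=
    { inner := fun f g => f.sum fun s a => g.sum fun t b => starRingEnd ℂ a * b * N s t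
      conj_inner_symm := by
        intro x y
        simp only [Finsupp.sum, map_sum, map_mul]
        rw [Finset.sum_comm]
        refine Finset.sum_congr rfl fun s _ => Finset.sum_congr rfl fun t _ => ?_
        simp only [herm s t, Complex.conj_conj]; ring
      re_inner_nonneg := fun f => psd f
      add_left := by
        intro x y z
        classical
        refine Finsupp.sum_add_index' ?_ ?_
        · intro s; simp
        · intro s b c
          rw [← Finsupp.sum_add]
          simp [add_mul]
      smul_left := by
        intro x y r
        change (r • x).sum _ = _ * x.sum _
        rw [Finsupp.sum_smul_index (by intro i; simp), Finsupp.mul_sum]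
        refine Finset.sum_congr rfl fun s _ => ?_
        dsimp only
        rw [Finsupp.mul_sum]
        refine Finset.sum_congr rfl fun t _ => ?_
        simp; ring }
  let i1 : SeminormedAddCommGroup (S →₀ ℂ) := @InnerProductSpace.Core.toSeminormedAddCommGroup ℂ _ _ _ _ core
  let i2 : InnerProductSpace ℂ (S →₀ ℂ) := InnerProductSpace.ofCore core
  refine ⟨UniformSpace.Completion (S →₀ ℂ), inferInstance, inferInstance, inferInstance,
    fun s => ((Finsupp.single s 1 : S →₀ ℂ) : UniformSpace.Completion (S →₀ ℂ)), ?_, ?_⟩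
  · intro s t
    rw [UniformSpace.Completion.inner_coe]
    change (Finsupp.single s (1:ℂ)).sum _ = _
    rw [Finsupp.sum_single_index (by simp), Finsupp.sum_single_index (by simp)]
    simp
  · have : ∀ f : S →₀ ℂ, Finsupp.linearCombination ℂ (fun s => ((Finsupp.single s 1 : S →₀ ℂ) : UniformSpace.Completion (S →₀ ℂ))) f = (f : UniformSpace.Completion (S →₀ ℂ)) := by
      intro f
      have h2 : (UniformSpace.Completion.toComplL (𝕜 := ℂ) (E := S →₀ ℂ)).toLinearMap f = (f : UniformSpace.Completion (S →₀ ℂ)) := rfl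
      rw [← h2]
      congr 1
      ext s
      simp
    have h3 : (⇑(Finsupp.linearCombination ℂ (fun s => ((Finsupp.single s 1 : S →₀ ℂ) : UniformSpace.Completion (S →₀ ℂ))))) = ((↑) : (S →₀ ℂ) → UniformSpace.Completion (S →₀ ℂ)) := funext this
    rw [h3]
    exact UniformSpace.Completion.denseRange_coe

theorem aux_restrict {G : Type*} [Group G] {W : Type*}
    [NormedAddCommGroup W] [InnerProductSpace ℂ W]
    (ρ : G →* (W ≃ₗᵢ[ℂ] W)) (M : Submodule ℂ W) (hM : ∀ g, ∀ w ∈ M, ρ g w ∈ M) :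
    ∃ ρ' : G →* (M ≃ₗᵢ[ℂ] M), ∀ g (w : M), ((ρ' g w : M) : W) = ρ g w := by
  let f : G → (M ≃ₗᵢ[ℂ] M) := fun g =>
    { toFun := fun w => ⟨ρ g w, hM g w w.2⟩
      invFun := fun w => ⟨ρ g⁻¹ w, hM g⁻¹ w w.2⟩
      map_add' := fun x y => by ext; simp
      map_smul' := fun x y => by ext; simp
      left_inv := fun x => by ext; simp only [aux_inv']
      right_inv := fun x => by ext; simp only [aux_inv]
      norm_map' := fun x => (ρ g).norm_map x }
  refine ⟨MonoidHom.mk' f ?_, fun g w => rfl⟩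
  intro g h
  ext w
  change ρ (g * h) w = ρ g (ρ h w)
  rw [map_mul]; rfl

theorem aux_inner_self {W : Type*} [NormedAddCommGroup W] [InnerProductSpace ℂ W] (x : W) :
    inner ℂ x x = ((‖x‖ ^ 2 : ℝ) : ℂ) := by
  rw [inner_self_eq_norm_sq_to_K]; push_cast; rfl

theorem aux_inner_sum {W ι κ : Type*} [NormedAddCommGroup W] [InnerProductSpace ℂ W]
    (F : Finset ι) (F' : Finset κ) (a : ι → ℂ) (b : κ → ℂ) (x : ι → W) (y : κ → W) :
    inner ℂ (∑ s ∈ F, a s • x s) (∑ t ∈ F', b t • y t) =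
      ∑ s ∈ F, ∑ t ∈ F', starRingEnd ℂ (a s) * b t * inner ℂ (x s) (y t) := by
  rw [sum_inner]
  refine Finset.sum_congr rfl fun s _ => ?_
  rw [inner_smul_left, inner_sum, Finset.mul_sum]
  refine Finset.sum_congr rfl fun t _ => ?_
  rw [inner_smul_right]; ring

/-- Normalised positive definite invariant kernels. -/
noncomputable def auxK {G : Type u} [Group G] {k : ℕ} (X : Fin k → Subgroup G) :
    Set (G × Fin k → G × Fin k → ℂ) :=
  {N | (∀ s t, N t s = starRingEnd ℂ (N s t)) ∧
    (∀ f : G × Fin k →₀ ℂ,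
      0 ≤ (f.sum fun s a => f.sum fun t b => starRingEnd ℂ a * b * N s t).re) ∧
    (∀ g s t, N (g * s.1, s.2) (g * t.1, t.2) = N s t) ∧
    (∀ i, ∀ x ∈ X i, ∀ g t, N (g * x, i) t = N (g, i) t) ∧
    ∑ i, N (1, i) (1, i) = 1}

theorem auxK_closed {G : Type u} [Group G] {k : ℕ} (X : Fin k → Subgroup G) :
    IsClosed (auxK X) := by
  have hc : ∀ s t, Continuous (fun N : G × Fin k → G × Fin k → ℂ => N s t) := fun s t =>
    (continuous_apply t).comp (continuous_apply s)
  simp only [auxK, Set.setOf_and, Set.setOf_forall]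
  refine IsClosed.inter ?_ (IsClosed.inter ?_ (IsClosed.inter ?_ (IsClosed.inter ?_ ?_)))
  · exact isClosed_iInter fun s => isClosed_iInter fun t =>
      isClosed_eq (hc _ _) (Complex.continuous_conj.comp (hc _ _))
  · refine isClosed_iInter fun f => isClosed_le continuous_const (Complex.continuous_re.comp ?_)
    simp only [Finsupp.sum]
    exact continuous_finsetSum _ fun s _ => continuous_finsetSum _ fun t _ =>
      continuous_const.mul (hc _ _)
  · exact isClosed_iInter fun g => isClosed_iInter fun s => isClosed_iInter fun t =>
      isClosed_eq (hc _ _) (hc _ _)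
  · exact isClosed_iInter fun i => isClosed_iInter fun x => isClosed_iInter fun hx =>
      isClosed_iInter fun g => isClosed_iInter fun t => isClosed_eq (hc _ _) (hc _ _)
  · exact isClosed_eq (continuous_finsetSum _ fun i _ => hc _ _) continuous_const

theorem auxK_bound {G : Type u} [Group G] {k : ℕ} (X : Fin k → Subgroup G)
    {N : G × Fin k → G × Fin k → ℂ} (hN : N ∈ auxK X) (s t) : ‖N s t‖ ≤ 1 := by
  obtain ⟨h1, h2, h3, h4, h5⟩ := hN
  obtain ⟨W, _, _, _, ξ, hξ, -⟩ := aux_gns N h1 h2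
  have hn : ∀ s, ‖ξ s‖ ≤ 1 := by
    rintro ⟨g, i⟩
    have e1 : ‖ξ (g, i)‖ ^ 2 = ‖ξ (1, i)‖ ^ 2 := by
      have := h3 g (1, i) (1, i)
      rw [← hξ, ← hξ, aux_inner_self, aux_inner_self] at this
      simp only [mul_one] at this
      exact_mod_cast this
    have e2 : ∑ i, ‖ξ (1, i)‖ ^ 2 = 1 := by
      simp only [← hξ, aux_inner_self, ← Complex.ofReal_sum] at h5
      exact_mod_cast h5
    have e3 : ‖ξ (1, i)‖ ^ 2 ≤ 1 := by
      rw [← e2]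
      exact Finset.single_le_sum (f := fun i => ‖ξ (1, i)‖ ^ 2) (fun i _ => by positivity)
        (Finset.mem_univ i)
    rw [← e1] at e3
    nlinarith [norm_nonneg (ξ (g, i))]
  rw [← hξ]
  calc _ ≤ ‖ξ s‖ * ‖ξ t‖ := norm_inner_le_norm _ _
    _ ≤ 1 * 1 := by gcongr <;> apply hn
    _ = 1 := one_mul 1

theorem auxK_compact {G : Type u} [Group G] {k : ℕ} (X : Fin k → Subgroup G) :
    IsCompact (auxK X) := by
  have hc : IsCompact (Set.univ.pi fun _ : G × Fin k => Set.univ.pi fun _ : G × Fin k =>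
      Metric.closedBall (0 : ℂ) 1) :=
    isCompact_univ_pi fun _ => isCompact_univ_pi fun _ => isCompact_closedBall _ _
  refine hc.of_isClosed_subset (auxK_closed X) ?_
  intro N hN s _ t _
  simpa using auxK_bound X hN s t

theorem auxK_mem {G : Type u} [Group G] {k : ℕ} (X : Fin k → Subgroup G)
    {W : Type*} [NormedAddCommGroup W] [InnerProductSpace ℂ W]
    (ρ : G →* (W ≃ₗᵢ[ℂ] W)) (w : Fin k → W) (hw : ∀ i, ∀ g ∈ X i, ρ g (w i) = w i)
    (A : W →L[ℂ] W) (hA : ∀ g x, A (ρ g x) = ρ g (A x))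
    (hs : ∀ x y, inner ℂ (A x) y = inner ℂ x (A y))
    (hp : ∀ x, 0 ≤ (inner ℂ x (A x)).re)
    (ht : ∑ i, inner ℂ (w i) (A (w i)) = 1) :
    (fun s t : G × Fin k => inner ℂ (ρ s.1 (w s.2)) (A (ρ t.1 (w t.2)))) ∈ auxK X := by
  refine ⟨?_, ?_, ?_, ?_, ?_⟩
  · intro s t
    rw [inner_conj_symm, hs]
  · intro f
    have : (f.sum fun s a => f.sum fun t b => starRingEnd ℂ a * b *
        inner ℂ (ρ s.1 (w s.2)) (A (ρ t.1 (w t.2)))) =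
      inner ℂ (f.sum fun s a => a • ρ s.1 (w s.2)) (A (f.sum fun s a => a • ρ s.1 (w s.2))) := by
      simp only [Finsupp.sum, map_sum, map_smul, aux_inner_sum]
    rw [this]
    exact hp _
  · intro g s t
    simp only [aux_mul, hA, LinearIsometryEquiv.inner_map_map]
  · intro i x hx g t
    simp only [aux_mul, hw i x hx]
  · simpa [aux_one] using ht

/-- The linear functional on kernels. -/
noncomputable def auxΦ {G : Type u} {k : ℕ} (f : G →₀ ℂ) (i j : Fin k) :
    (G × Fin k → G × Fin k → ℂ) →L[ℝ] ℂ :=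
  ∑ g ∈ f.support, ∑ h ∈ f.support, (starRingEnd ℂ (f g) * f h) •
    ((ContinuousLinearMap.proj (R := ℝ) (φ := fun _ : G × Fin k => ℂ) (h, j)).comp
      (ContinuousLinearMap.proj (R := ℝ) (φ := fun _ : G × Fin k => (G × Fin k → ℂ)) (g, i)))

/-- The linear functional to be maximised. -/
noncomputable def auxΛ {G : Type u} {k : ℕ} (f : G →₀ ℂ) (C : ℝ) :
    (G × Fin k → G × Fin k → ℂ) →L[ℝ] ℝ :=
  Complex.reCLM.comp ((∑ i, ∑ j, auxΦ f i j) - C • ∑ i, auxΦ f i i)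

theorem auxΦ_apply {G : Type u} [Group G] {k : ℕ} (f : G →₀ ℂ) (i j : Fin k)
    {W : Type*} [NormedAddCommGroup W] [InnerProductSpace ℂ W]
    (ρ : G →* (W ≃ₗᵢ[ℂ] W)) (w : Fin k → W) :
    auxΦ f i j (fun s t : G × Fin k => inner ℂ (ρ s.1 (w s.2)) (ρ t.1 (w t.2))) =
      inner ℂ (f.sum fun g a => a • ρ g (w i)) (f.sum fun g a => a • ρ g (w j)) := by
  simp only [auxΦ, Finsupp.sum, aux_inner_sum,
    ContinuousLinearMap.sum_apply, ContinuousLinearMap.smul_apply, ContinuousLinearMap.comp_apply,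
    ContinuousLinearMap.proj_apply, smul_eq_mul]

theorem auxΛ_apply {G : Type u} [Group G] {k : ℕ} (f : G →₀ ℂ) (C : ℝ)
    {W : Type*} [NormedAddCommGroup W] [InnerProductSpace ℂ W]
    (ρ : G →* (W ≃ₗᵢ[ℂ] W)) (w : Fin k → W) :
    auxΛ f C (fun s t : G × Fin k => inner ℂ (ρ s.1 (w s.2)) (ρ t.1 (w t.2))) =
      ‖∑ i, f.sum fun g a => a • ρ g (w i)‖ ^ 2
        - C * ∑ i, ‖f.sum fun g a => a • ρ g (w i)‖ ^ 2 := by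
  rw [auxΛ, ContinuousLinearMap.comp_apply, ContinuousLinearMap.sub_apply,
    ContinuousLinearMap.smul_apply]
  simp only [ContinuousLinearMap.sum_apply, auxΦ_apply]
  simp only [← inner_sum, ← sum_inner, inner_self_eq_norm_sq_to_K]
  rw [Complex.reCLM_apply, Complex.sub_re, Complex.smul_re]
  congr 1
  · norm_cast
  · rw [smul_eq_mul]
    congr 1
    rw [Complex.re_sum]
    refine Finset.sum_congr rfl fun i _ => ?_
    norm_cast

theorem aux_extreme {G : Type u} [Group G] {k : ℕ} (X : Fin k → Subgroup G) (f : G →₀ ℂ) (C : ℝ)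
    (V : Type u) [NormedAddCommGroup V] [InnerProductSpace ℂ V] [CompleteSpace V]
    (ρ : G →* (V ≃ₗᵢ[ℂ] V))
    (v : Fin k → V) (hv : ∀ i, ∀ g ∈ X i, ρ g (v i) = v i)
    (hlt : C * ∑ i, ‖f.sum fun g a => a • ρ g (v i)‖ ^ 2 <
      ‖∑ i, f.sum fun g a => a • ρ g (v i)‖ ^ 2) :
    ∃ (W : Type u) (_ : NormedAddCommGroup W) (_ : InnerProductSpace ℂ W) (_ : CompleteSpace W)
      (ρ' : G →* (W ≃ₗᵢ[ℂ] W)) (w : Fin k → W),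
      (∀ i, ∀ g ∈ X i, ρ' g (w i) = w i) ∧
      (C * ∑ i, ‖f.sum fun g a => a • ρ' g (w i)‖ ^ 2 <
        ‖∑ i, f.sum fun g a => a • ρ' g (w i)‖ ^ 2) ∧
      (∀ A : W →L[ℂ] W, (∀ g x, A (ρ' g x) = ρ' g (A x)) → ∃ c : ℂ, ∀ x, A x = c • x) := by
  -- initial point
  obtain ⟨N0, hN0, hΛ0⟩ : ∃ N0 ∈ auxK X, 0 < auxΛ f C N0 := by
    have hne : 0 < ∑ i, ‖v i‖ ^ 2 := by
      rcases (Finset.sum_nonneg fun i (_ : i ∈ Finset.univ) => sq_nonneg ‖v i‖).lt_or_eq with h | h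
      · exact h
      · exfalso
        have h0 : ∀ i, v i = 0 := by
          intro i
          have := (Finset.sum_eq_zero_iff_of_nonneg
            (fun i (_ : i ∈ Finset.univ) => sq_nonneg ‖v i‖)).1 h.symm i (Finset.mem_univ i)
          simpa using this
        simp [h0] at hlt
    set r := ∑ i, ‖v i‖ ^ 2 with hr
    set c : ℝ := (Real.sqrt r)⁻¹ with hc
    have hsr : 0 < Real.sqrt r := Real.sqrt_pos.2 hne
    have hcp : 0 < c := inv_pos.2 hsr
    have hcr : c ^ 2 * r = 1 := by
      rw [hc, inv_pow, Real.sq_sqrt hne.le, inv_mul_cancel₀ hne.ne']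
    refine ⟨_, auxK_mem X ρ (fun i => (c : ℂ) • v i) ?_ (ContinuousLinearMap.id ℂ V)
      (fun _ _ => rfl) (fun _ _ => rfl) ?_ ?_, ?_⟩
    · intro i g hg
      rw [map_smul, hv i g hg]
    · intro x
      simp only [ContinuousLinearMap.id_apply]
      exact inner_self_nonneg (𝕜 := ℂ)
    · simp only [ContinuousLinearMap.id_apply, aux_inner_self, norm_smul, ← Complex.ofReal_sum]
      have : ∑ i, (‖(c : ℂ)‖ * ‖v i‖) ^ 2 = 1 := by
        simp only [mul_pow, ← Finset.mul_sum]
        rw [Complex.norm_real, Real.norm_of_nonneg hcp.le, hcr]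
      rw [this, Complex.ofReal_one]
    · simp only [ContinuousLinearMap.id_apply]
      rw [auxΛ_apply f C ρ (fun i => (c : ℂ) • v i)]
      have e : ∀ i, (f.sum fun g a => a • ρ g ((c : ℂ) • v i)) =
          (c : ℂ) • f.sum fun g a => a • ρ g (v i) := by
        intro i
        rw [Finsupp.smul_sum]
        refine Finset.sum_congr rfl fun g _ => ?_
        simp only [map_smul]
        rw [smul_comm]
      simp only [e, ← Finset.smul_sum, norm_smul, mul_pow, ← Finset.mul_sum]
      rw [Complex.norm_real, Real.norm_of_nonneg hcp.le]
      have : 0 < c ^ 2 := by positivity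
      nlinarith
  -- extreme maximiser
  obtain ⟨N, hNext, hNmax⟩ : ∃ N ∈ (auxK X).extremePoints ℝ, ∀ y ∈ auxK X, auxΛ f C y ≤ auxΛ f C N := by
    have hexp : IsExposed ℝ (auxK X) ((auxΛ f C).toExposed (auxK X)) :=
      ContinuousLinearMap.toExposed.isExposed
    have hcomp := hexp.isCompact (auxK_compact X)
    have hne : ((auxΛ f C).toExposed (auxK X)).Nonempty := by
      obtain ⟨z, hz, hz2⟩ := (auxK_compact X).exists_isMaxOn ⟨N0, hN0⟩
        (auxΛ f C).continuous.continuousOn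
      exact ⟨z, hz, fun y hy => hz2 hy⟩
    obtain ⟨N, hN⟩ := hcomp.extremePoints_nonempty hne
    exact ⟨N, hexp.isExtreme.extremePoints_subset_extremePoints hN, (extremePoints_subset hN).2⟩
  have hNK : N ∈ auxK X := extremePoints_subset hNext
  obtain ⟨h1, h2, h3, h4, h5⟩ := hNK
  obtain ⟨W, _, _, _, ξ, hξ, hdense⟩ := aux_gns N h1 h2
  have hlc : ∀ φ ψ : G × Fin k →₀ ℂ, inner ℂ (Finsupp.linearCombination ℂ ξ φ)
      (Finsupp.linearCombination ℂ ξ ψ) =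
      φ.sum fun s a => ψ.sum fun t b => starRingEnd ℂ a * b * N s t := by
    intro φ ψ
    simp only [Finsupp.linearCombination_apply, Finsupp.sum, aux_inner_sum, hξ]
  let σ : G → (G × Fin k ≃ G × Fin k) := fun g => (Equiv.mulLeft g).prodCongr (Equiv.refl _)
  have hσ : ∀ g s, σ g s = (g * s.1, s.2) := fun g s => rfl
  have hmul : ∀ g h (x : G × Fin k →₀ ℂ), Finsupp.domLCongr (R := ℂ) (σ (g * h)) x =
      Finsupp.domLCongr (R := ℂ) (σ g) (Finsupp.domLCongr (R := ℂ) (σ h) x) := by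
    intro g h x
    simp only [Finsupp.domLCongr_apply, Finsupp.domCongr_apply,
      Finsupp.equivMapDomain_eq_mapDomain, ← Finsupp.mapDomain_comp]
    congr 1
    funext s
    simp only [Function.comp, hσ, mul_assoc]
  have hnorm : ∀ g (x : G × Fin k →₀ ℂ), ‖(Finsupp.linearCombination ℂ ξ) ((Finsupp.domLCongr (R := ℂ) (σ g)) x)‖ =
      ‖Finsupp.linearCombination ℂ ξ x‖ := by
    intro g x
    have : ‖(Finsupp.linearCombination ℂ ξ) ((Finsupp.domLCongr (R := ℂ) (σ g)) x)‖ ^ 2 =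
        ‖Finsupp.linearCombination ℂ ξ x‖ ^ 2 := by
      rw [← Complex.ofReal_inj, ← aux_inner_self, ← aux_inner_self, hlc, hlc]
      simp only [Finsupp.domLCongr_apply, Finsupp.domCongr_apply,
        Finsupp.equivMapDomain_eq_mapDomain]
      rw [Finsupp.sum_mapDomain_index (by simp) (by intros; simp [add_mul, Finsupp.sum_add])]
      refine Finset.sum_congr rfl fun s _ => ?_
      dsimp only
      rw [Finsupp.sum_mapDomain_index (by simp) (by intros; simp [add_mul, mul_add])]
      refine Finset.sum_congr rfl fun t _ => ?_
      dsimp only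
      rw [hσ, hσ, h3]
    exact (sq_eq_sq₀ (norm_nonneg _) (norm_nonneg _)).1 this
  obtain ⟨ρ', hρ'⟩ := aux_rep_extend (G := G) (Finsupp.linearCombination ℂ ξ) hdense
    (fun g => Finsupp.domLCongr (R := ℂ) (σ g)) hmul hnorm
  have hρξ : ∀ g s, ρ' g (ξ s) = ξ (g * s.1, s.2) := by
    intro g s
    have := hρ' g (Finsupp.single s 1)
    simpa [Finsupp.domLCongr_single, hσ] using this
  have hξe : ∀ s, ξ s = ρ' s.1 (ξ (1, s.2)) := by
    intro s; rw [hρξ]; simp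
  have hNe : N = fun s t : G × Fin k => inner ℂ (ρ' s.1 (ξ (1, s.2))) (ρ' t.1 (ξ (1, t.2))) := by
    ext s t
    rw [← hξe, ← hξe, hξ]
  have hw : ∀ i, ∀ g ∈ X i, ρ' g (ξ (1, i)) = ξ (1, i) := by
    intro i g hg
    rw [hρξ]
    have e : ∀ t, inner ℂ (ξ (g, i)) (ξ t) = inner ℂ (ξ (1, i)) (ξ t) := by
      intro t
      rw [hξ, hξ]
      have := h4 i g hg 1 t
      simpa using this
    have e2 : inner ℂ (ξ (g, i) - ξ (1, i)) (ξ (g, i) - ξ (1, i)) = 0 := by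
      rw [inner_sub_right, inner_sub_left, inner_sub_left, e, e]; simp
    have := inner_self_eq_zero.1 e2
    simpa using sub_eq_zero.1 this
  refine ⟨W, inferInstance, inferInstance, inferInstance, ρ', fun i => ξ (1, i), hw, ?_, ?_⟩
  · have := hΛ0.trans_le (hNmax N0 hN0)
    rw [hNe, auxΛ_apply f C ρ' (fun i => ξ (1, i))] at this
    linarith
  · -- self-adjoint small case
    have sa : ∀ B : W →L[ℂ] W, (∀ g x, B (ρ' g x) = ρ' g (B x)) →
        (∀ x y, inner ℂ (B x) y = inner ℂ x (B y)) → ‖B‖ ≤ 1 / 2 → ∃ c : ℂ, ∀ x, B x = c • x := by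
      intro B hB hBs hBn
      have hre : ∀ x, (((inner ℂ x (B x)).re : ℝ) : ℂ) = inner ℂ x (B x) := by
        intro x
        rw [← Complex.conj_eq_iff_re, inner_conj_symm, hBs]
      have hbd : ∀ x, |(inner ℂ x (B x)).re| ≤ 1 / 2 * ‖x‖ ^ 2 := by
        intro x
        calc |(inner ℂ x (B x)).re| ≤ ‖inner ℂ x (B x)‖ := Complex.abs_re_le_norm _
          _ ≤ ‖x‖ * ‖B x‖ := norm_inner_le_norm _ _
          _ ≤ ‖x‖ * (1 / 2 * ‖x‖) := by gcongr; exact B.le_of_opNorm_le hBn x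
          _ = _ := by ring
      have htr : ∑ i, inner ℂ (ξ (1, i)) (ξ (1, i)) = 1 := by simpa only [hξ] using h5
      have htr' : ∑ i, ‖ξ (1, i)‖ ^ 2 = 1 := by
        simp only [aux_inner_self, ← Complex.ofReal_sum] at htr
        exact_mod_cast htr
      set τ : ℝ := ∑ i, (inner ℂ (ξ (1, i)) (B (ξ (1, i)))).re with hτ
      have hτc : (τ : ℂ) = ∑ i, inner ℂ (ξ (1, i)) (B (ξ (1, i))) := by
        rw [hτ]; push_cast; simp only [hre]
      have hτb : |τ| ≤ 1 / 2 := by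
        calc |τ| ≤ ∑ i, |(inner ℂ (ξ (1, i)) (B (ξ (1, i)))).re| := Finset.abs_sum_le_sum_abs _ _
          _ ≤ ∑ i, 1 / 2 * ‖ξ (1, i)‖ ^ 2 := Finset.sum_le_sum fun i _ => hbd _
          _ = 1 / 2 := by rw [← Finset.mul_sum, htr', mul_one]
      rw [abs_le] at hτb
      -- members
      have mem : ∀ e : ℝ, |e| = 1 →
          (fun s t : G × Fin k => inner ℂ (ρ' s.1 (ξ (1, s.2)))
            (((((1 + e * τ)⁻¹ : ℝ) : ℂ) • (ContinuousLinearMap.id ℂ W + (e : ℂ) • B))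
              (ρ' t.1 (ξ (1, t.2))))) ∈ auxK X := by
        intro e he
        have hpos : 0 < 1 + e * τ := by
          rcases eq_or_eq_neg_of_abs_eq he with rfl | rfl <;> linarith
        refine auxK_mem X ρ' (fun i => ξ (1, i)) hw
          ((((1 + e * τ)⁻¹ : ℝ) : ℂ) • (ContinuousLinearMap.id ℂ W + (e : ℂ) • B)) ?_ ?_ ?_ ?_
        · intro g x
          simp only [ContinuousLinearMap.smul_apply, ContinuousLinearMap.add_apply,
            ContinuousLinearMap.id_apply, map_add, map_smul, hB]
        · intro x y
          simp only [ContinuousLinearMap.smul_apply, ContinuousLinearMap.add_apply,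
            ContinuousLinearMap.id_apply, inner_smul_left, inner_smul_right, inner_add_left,
            inner_add_right, hBs, Complex.conj_ofReal]
        · intro x
          simp only [ContinuousLinearMap.smul_apply, ContinuousLinearMap.add_apply,
            ContinuousLinearMap.id_apply, inner_smul_right,
            inner_add_right]
          rw [Complex.re_ofReal_mul, Complex.add_re, Complex.re_ofReal_mul]
          have hx : (inner ℂ x x).re = ‖x‖ ^ 2 := inner_self_eq_norm_sq (𝕜 := ℂ) x
          rw [hx]
          have := abs_le.1 (hbd x)
          refine mul_nonneg (inv_nonneg.2 hpos.le) ?_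
          rcases eq_or_eq_neg_of_abs_eq he with rfl | rfl <;> nlinarith [sq_nonneg ‖x‖]
        · simp only [ContinuousLinearMap.smul_apply, ContinuousLinearMap.add_apply,
            ContinuousLinearMap.id_apply, inner_smul_right,
            inner_add_right, ← Finset.mul_sum, Finset.sum_add_distrib, htr, ← hτc]
          have : (1 + e * τ)⁻¹ * (1 + e * τ) = 1 := inv_mul_cancel₀ hpos.ne'
          exact_mod_cast this
      have m1 := mem 1 (by simp)
      have m2 := mem (-1) (by simp)
      have hseg : N ∈ openSegment ℝ
          (fun s t : G × Fin k => inner ℂ (ρ' s.1 (ξ (1, s.2)))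
            (((((1 + 1 * τ)⁻¹ : ℝ) : ℂ) • (ContinuousLinearMap.id ℂ W + ((1 : ℝ) : ℂ) • B))
              (ρ' t.1 (ξ (1, t.2)))))
          (fun s t : G × Fin k => inner ℂ (ρ' s.1 (ξ (1, s.2)))
            (((((1 + (-1) * τ)⁻¹ : ℝ) : ℂ) • (ContinuousLinearMap.id ℂ W + ((-1 : ℝ) : ℂ) • B))
              (ρ' t.1 (ξ (1, t.2))))) := by
        refine ⟨(1 + τ) / 2, (1 - τ) / 2, by linarith, by linarith, by ring, ?_⟩
        rw [hNe]
        ext s t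
        simp only [ContinuousLinearMap.smul_apply, ContinuousLinearMap.add_apply,
            ContinuousLinearMap.id_apply, inner_smul_right, Pi.add_apply, Pi.smul_apply,
            inner_add_right, Complex.real_smul]
        have t1 : (1 + τ : ℂ) ≠ 0 := by
          have : (1 + τ : ℝ) ≠ 0 := by linarith
          exact_mod_cast this
        have t2 : (1 - τ : ℂ) ≠ 0 := by
          have : (1 - τ : ℝ) ≠ 0 := by linarith
          exact_mod_cast this
        have t3 : (1 + -τ : ℂ) ≠ 0 := by rwa [← sub_eq_add_neg]
        push_cast
        field_simp
        ring_nf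
      have heq := (mem_extremePoints.1 hNext).2 _ m1 _ m2 hseg
      have heq1 := heq.1
      refine ⟨τ, ?_⟩
      have key : ∀ s t, inner ℂ (ξ s) (B (ξ t) - (τ : ℂ) • ξ t) = 0 := by
        intro s t
        have := congrFun (congrFun heq1 s) t
        rw [← hξ s t] at this
        simp only [← hξe] at this
        simp only [ContinuousLinearMap.smul_apply, ContinuousLinearMap.add_apply,
            ContinuousLinearMap.id_apply, inner_smul_right, 
            inner_add_right] at this
        have t1 : (1 + τ : ℂ) ≠ 0 := by
          have : (1 + τ : ℝ) ≠ 0 := by linarith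
          exact_mod_cast this
        push_cast at this
        rw [one_mul, one_mul, inv_mul_eq_iff_eq_mul₀ t1] at this
        rw [inner_sub_right, inner_smul_right]
        linear_combination this
      have key2 : ∀ t, B (ξ t) = (τ : ℂ) • ξ t := by
        intro t
        rw [← sub_eq_zero]
        refine hdense.eq_zero_of_inner_left ℂ ?_
        intro φ
        rw [inner_eq_zero_symm, Finsupp.linearCombination_apply, Finsupp.sum, sum_inner]
        refine Finset.sum_eq_zero fun s _ => ?_
        rw [inner_smul_left, key, mul_zero]
      intro x
      refine hdense.induction_on (p := fun x => B x = (τ : ℂ) • x) x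
        (isClosed_eq B.continuous (continuous_const_smul _)) ?_
      intro φ
      simp only [Finsupp.linearCombination_apply, Finsupp.sum, map_sum, map_smul, key2,
        Finset.smul_sum]
      refine Finset.sum_congr rfl fun s _ => by rw [smul_comm]
    have sa2 : ∀ B : W →L[ℂ] W, (∀ g x, B (ρ' g x) = ρ' g (B x)) →
        (∀ x y, inner ℂ (B x) y = inner ℂ x (B y)) → ∃ c : ℂ, ∀ x, B x = c • x := by
      intro B hB hBs
      set r : ℝ := (2 * (‖B‖ + 1))⁻¹ with hr
      have hB0 := norm_nonneg B
      have hrp : 0 < r := by positivity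
      obtain ⟨c, hc⟩ := sa ((r : ℂ) • B) (by intro g x; simp only [ContinuousLinearMap.smul_apply, hB, map_smul])
        (by intro x y; simp only [ContinuousLinearMap.smul_apply, inner_smul_left,
          inner_smul_right, hBs, Complex.conj_ofReal]) (by
          rw [norm_smul, Complex.norm_real, Real.norm_of_nonneg hrp.le, hr]
          rw [inv_mul_le_iff₀ (by positivity)]
          linarith)
      refine ⟨(r : ℂ)⁻¹ * c, fun x => ?_⟩
      have hr0 : (r : ℂ) ≠ 0 := by exact_mod_cast hrp.ne'
      rw [mul_smul, ← hc x, ContinuousLinearMap.smul_apply, inv_smul_smul₀ hr0]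
    intro A hA
    have hAd : ∀ g x, A.adjoint (ρ' g x) = ρ' g (A.adjoint x) := by
      intro g x
      refine ext_inner_right ℂ fun y => ?_
      rw [ContinuousLinearMap.adjoint_inner_left, aux_adj, ← hA, aux_adj,
        ContinuousLinearMap.adjoint_inner_left]
    obtain ⟨c, hc⟩ := sa2 (A + A.adjoint) (by intro g x; simp [hA, hAd]) (by
      intro x y
      simp [inner_add_left, inner_add_right, ContinuousLinearMap.adjoint_inner_left,
        ContinuousLinearMap.adjoint_inner_right, add_comm])
    obtain ⟨d, hd⟩ := sa2 (Complex.I • (A - A.adjoint)) (by intro g x; simp [hA, hAd]) (by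
      intro x y
      simp [inner_sub_left, inner_sub_right, ContinuousLinearMap.adjoint_inner_left,
        ContinuousLinearMap.adjoint_inner_right, inner_smul_left, inner_smul_right]
      ring)
    refine ⟨(c - Complex.I * d) / 2, fun x => ?_⟩
    have e1 := hc x
    have e2 := hd x
    simp only [ContinuousLinearMap.smul_apply, ContinuousLinearMap.add_apply,
      ContinuousLinearMap.sub_apply] at e1 e2
    have e3 : A x - A.adjoint x = -(Complex.I * d) • x := by
      rw [neg_smul, mul_smul, ← e2, smul_smul, Complex.I_mul_I]; simp
    have e4 : (2 : ℂ) • A x = (c - Complex.I * d) • x := by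
      rw [sub_eq_add_neg, add_smul, ← e1, ← e3]; module
    rw [div_eq_inv_mul, mul_smul, ← e4, inv_smul_smul₀ two_ne_zero]

/-- Codistance hypothesis for the quotient. -/
def auxQuot {G : Type u} [Group G] {k : ℕ} (X : Fin k → Subgroup G) (H : Subgroup G) (ε : ℝ) :
    Prop :=
  ∀ (W : Type u) [NormedAddCommGroup W] [InnerProductSpace ℂ W] [CompleteSpace W],
      ∀ ρ : G →* (W ≃ₗᵢ[ℂ] W),
        (∀ h ∈ H, ∀ w : W, ρ h w = w) →
        (∀ w : W, (∀ g : G, ρ g w = w) → w = 0) →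
        ∀ w : Fin k → W, (∀ i, ∀ g ∈ X i, ρ g (w i) = w i) →
        ‖∑ i, w i‖ ^ 2 ≤ (1 - ε) * k * ∑ i, ‖w i‖ ^ 2

/-- Fixed vectors of a subgroup. -/
def auxFix {G W : Type*} [Group G] [NormedAddCommGroup W] [InnerProductSpace ℂ W]
    (ρ : G →* (W ≃ₗᵢ[ℂ] W)) (H : Subgroup G) : Submodule ℂ W where
  carrier := {w | ∀ h ∈ H, ρ h w = w}
  add_mem' := by
    intro a b ha hb h hh
    rw [map_add, ha h hh, hb h hh]
  zero_mem' := by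
    intro h hh
    rw [map_zero]
  smul_mem' := by
    intro c x hx h hh
    rw [map_smul, hx h hh]

theorem auxFix_mem {G W : Type*} [Group G] [NormedAddCommGroup W] [InnerProductSpace ℂ W]
    (ρ : G →* (W ≃ₗᵢ[ℂ] W)) (H : Subgroup G) (w : W) :
    w ∈ auxFix ρ H ↔ ∀ h ∈ H, ρ h w = w := Iff.rfl

theorem auxFix_closed {G W : Type*} [Group G] [NormedAddCommGroup W] [InnerProductSpace ℂ W]
    (ρ : G →* (W ≃ₗᵢ[ℂ] W)) (H : Subgroup G) : IsClosed (auxFix ρ H : Set W) := by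
  have : (auxFix ρ H : Set W) = ⋂ h ∈ H, {w | ρ h w = w} := by
    ext w; simp [auxFix_mem]
  rw [this]
  exact isClosed_iInter fun h => isClosed_iInter fun _ =>
    isClosed_eq (ρ h).continuous continuous_id

instance auxFix_complete {G W : Type*} [Group G] [NormedAddCommGroup W] [InnerProductSpace ℂ W]
    [CompleteSpace W]
    (ρ : G →* (W ≃ₗᵢ[ℂ] W)) (H : Subgroup G) : CompleteSpace (auxFix ρ H) :=
  (auxFix_closed ρ H).completeSpace_coe

theorem auxFix_inv {G W : Type*} [Group G] [NormedAddCommGroup W] [InnerProductSpace ℂ W]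
    (ρ : G →* (W ≃ₗᵢ[ℂ] W)) (H : Subgroup G) (hH : H.Normal) :
    ∀ g, ∀ w ∈ auxFix ρ H, ρ g w ∈ auxFix ρ H := by
  intro g w hw h hh
  have : h * g = g * (g⁻¹ * h * g) := by group
  rw [← aux_mul, this, aux_mul, hw]
  have := hH.conj_mem h hh g⁻¹
  simpa using this

theorem aux_orth_inv {G W : Type*} [Group G] [NormedAddCommGroup W] [InnerProductSpace ℂ W]
    (ρ : G →* (W ≃ₗᵢ[ℂ] W)) (M : Submodule ℂ W) (hM : ∀ g, ∀ w ∈ M, ρ g w ∈ M) :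
    ∀ g, ∀ w ∈ Mᗮ, ρ g w ∈ Mᗮ := by
  intro g w hw x hx
  rw [aux_adj']
  exact hw _ (hM _ _ hx)

theorem aux_proj_comm {G W : Type*} [Group G] [NormedAddCommGroup W] [InnerProductSpace ℂ W]
    (ρ : G →* (W ≃ₗᵢ[ℂ] W)) (M : Submodule ℂ W) [M.HasOrthogonalProjection]
    (hM : ∀ g, ∀ w ∈ M, ρ g w ∈ M) (g : G) (x : W) :
    M.starProjection (ρ g x) = ρ g (M.starProjection x) := by
  apply Submodule.eq_starProjection_of_mem_orthogonal
  · exact hM g _ (M.starProjection_apply_mem x)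
  · rw [← map_sub]
    exact aux_orth_inv ρ M hM g _ (M.sub_starProjection_mem_orthogonal x)

theorem aux_cs {W : Type*} [NormedAddCommGroup W] {k : ℕ} (x : Fin k → W) :
    ‖∑ i, x i‖ ^ 2 ≤ k * ∑ i, ‖x i‖ ^ 2 := by
  calc ‖∑ i, x i‖ ^ 2 ≤ (∑ i, ‖x i‖) ^ 2 := by gcongr; exact norm_sum_le _ _
    _ ≤ _ := by
      have := sq_sum_le_card_mul_sum_sq (s := (Finset.univ : Finset (Fin k))) (f := fun i => ‖x i‖)
      simpa using this

theorem aux_quot_restrict {G : Type u} [Group G] {k : ℕ} {X : Fin k → Subgroup G} {H : Subgroup G}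
    {ε : ℝ} (hquot : auxQuot X H ε)
    {W : Type u} [NormedAddCommGroup W] [InnerProductSpace ℂ W] [CompleteSpace W]
    (ρ : G →* (W ≃ₗᵢ[ℂ] W)) (M : Submodule ℂ W) (hMc : IsClosed (M : Set W))
    (hM : ∀ g, ∀ w ∈ M, ρ g w ∈ M)
    (hH : ∀ h ∈ H, ∀ w ∈ M, ρ h w = w) (hno : ∀ w ∈ M, (∀ g, ρ g w = w) → w = 0)
    (w : Fin k → W) (hwM : ∀ i, w i ∈ M) (hw : ∀ i, ∀ g ∈ X i, ρ g (w i) = w i) :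
    ‖∑ i, w i‖ ^ 2 ≤ (1 - ε) * k * ∑ i, ‖w i‖ ^ 2 := by
  obtain ⟨ρ', hρ'⟩ := aux_restrict ρ M hM
  haveI : CompleteSpace M := hMc.completeSpace_coe
  have := hquot M ρ' (fun h hh w => by ext; rw [hρ', hH h hh w w.2])
    (fun w hw => by
      ext
      exact hno w w.2 (fun g => by rw [← hρ', hw g]))
    (fun i => ⟨w i, hwM i⟩) (fun i g hg => by ext; rw [hρ']; exact hw i g hg)
  have e : ‖∑ i, (⟨w i, hwM i⟩ : M)‖ = ‖∑ i, w i‖ := by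
    rw [Submodule.coe_norm, Submodule.coe_sum]
  rw [e] at this
  exact this

theorem aux_L6 {G : Type u} [Group G] {k : ℕ} {X : Fin k → Subgroup G} {H : Subgroup G}
    {ε : ℝ} (hquot : auxQuot X H ε)
    {W : Type u} [NormedAddCommGroup W] [InnerProductSpace ℂ W] [CompleteSpace W]
    (ρ : G →* (W ≃ₗᵢ[ℂ] W)) (hH : ∀ h ∈ H, ∀ w, ρ h w = w)
    (q : Fin k → W) (hq : ∀ i, ∀ g ∈ X i, ρ g (q i) = q i) :
    ‖∑ i, q i‖ ^ 2 ≤ (1 - ε) * k * ∑ i, ‖q i‖ ^ 2 +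
      ε * k * ∑ i, ‖(auxFix ρ ⊤).starProjection (q i)‖ ^ 2 := by
  set M := auxFix ρ (⊤ : Subgroup G) with hMdef
  have hMinv : ∀ g, ∀ w ∈ M, ρ g w ∈ M := auxFix_inv ρ ⊤ inferInstance
  have h1 := aux_quot_restrict hquot ρ Mᗮ (Submodule.isClosed_orthogonal M)
    (aux_orth_inv ρ M hMinv) (fun h hh w _ => hH h hh w)
    (fun w hw hg => by
      have hwM : w ∈ M := fun g _ => hg g
      exact inner_self_eq_zero.1 (hw w hwM))
    (fun i => Mᗮ.starProjection (q i)) (fun i => Submodule.starProjection_apply_mem _ _)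
    (fun i g hg => by
      rw [← aux_proj_comm ρ Mᗮ (aux_orth_inv ρ M hMinv), hq i g hg])
  have h2 := aux_cs (fun i => M.starProjection (q i))
  have h3 := Submodule.norm_sq_eq_add_norm_sq_starProjection (∑ i, q i) M
  have h4 : ∑ i, ‖q i‖ ^ 2 = ∑ i, ‖M.starProjection (q i)‖ ^ 2 +
      ∑ i, ‖Mᗮ.starProjection (q i)‖ ^ 2 := by
    rw [← Finset.sum_add_distrib]
    exact Finset.sum_congr rfl fun i _ => Submodule.norm_sq_eq_add_norm_sq_starProjection (q i) M
  rw [map_sum, map_sum] at h3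
  rw [h3, h4]
  nlinarith

theorem aux_L8 {G : Type u} [Group G] {k : ℕ} {H : Subgroup G}
    {V : Type u} [NormedAddCommGroup V] [InnerProductSpace ℂ V] [CompleteSpace V]
    (ρ : G →* (V ≃ₗᵢ[ℂ] V)) (b : Fin k → V) (hb : ∀ i, b i ∈ (auxFix ρ H)ᗮ) (η : ℝ) (hη : 0 < η) :
    ∃ f : G →₀ ℂ, (∀ g ∈ f.support, g ∈ H) ∧ (f.sum fun _ a => a) = 0 ∧
      ∀ i, ‖(f.sum fun g a => a • ρ g (b i)) - b i‖ < η := by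
  classical
  let Y := PiLp 2 (fun _ : Fin k => V)
  let R : G → Y →L[ℂ] Y := fun g =>
    (LinearIsometryEquiv.piLpCongrRight 2 (fun _ : Fin k => ρ g)).toContinuousLinearEquiv.toContinuousLinearMap
  have hR : ∀ g (y : Y) i, R g y i = ρ g (y i) := fun g y i => rfl
  have hRn : ∀ g (y : Y), ‖R g y‖ = ‖y‖ := fun g y =>
    (LinearIsometryEquiv.piLpCongrRight 2 (fun _ : Fin k => ρ g)).norm_map y
  let B : Y := WithLp.toLp 2 b
  have hB : ∀ i, B i = b i := fun i => rfl
  let D : Submodule ℂ Y := Submodule.span ℂ {y | ∃ h ∈ H, y = R h B - B}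
  have hDT : ∀ y ∈ D, ∃ f : G →₀ ℂ, (∀ g ∈ f.support, g ∈ H) ∧ (f.sum fun _ a => a) = 0 ∧
      ∀ i, (f.sum fun g a => a • ρ g (b i)) = y i := by
    intro y hy
    induction hy using Submodule.span_induction with
    | mem y hy =>
      obtain ⟨h, hh, rfl⟩ := hy
      refine ⟨Finsupp.single h 1 - Finsupp.single 1 1, ?_, ?_, ?_⟩
      · intro g hg
        have := Finsupp.support_sub hg
        rcases Finset.mem_union.1 this with h' | h'
        · rw [Finset.mem_singleton.1 (Finsupp.support_single_subset h')]; exact hh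
        · rw [Finset.mem_singleton.1 (Finsupp.support_single_subset h')]; exact H.one_mem
      · rw [Finsupp.sum_sub_index (by intros; rfl)]; simp
      · intro i
        rw [Finsupp.sum_sub_index (by intros; rw [sub_smul])]
        rw [Finsupp.sum_single_index (by simp), Finsupp.sum_single_index (by simp), one_smul,
          one_smul, aux_one]
        rfl
    | zero => exact ⟨0, by simp, by simp, by simp⟩
    | add x y _ _ hx hy =>
      obtain ⟨f, f1, f2, f3⟩ := hx
      obtain ⟨f', f1', f2', f3'⟩ := hy
      refine ⟨f + f', ?_, ?_, ?_⟩
      · intro g hg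
        rcases Finset.mem_union.1 (Finsupp.support_add hg) with h' | h'
        · exact f1 g h'
        · exact f1' g h'
      · rw [Finsupp.sum_add_index' (by simp) (by simp), f2, f2', add_zero]
      · intro i
        rw [Finsupp.sum_add_index' (by simp) (by intros; rw [add_smul]), f3, f3']; rfl
    | smul c x _ hx =>
      obtain ⟨f, f1, f2, f3⟩ := hx
      refine ⟨c • f, ?_, ?_, ?_⟩
      · intro g hg
        exact f1 g (Finsupp.support_smul hg)
      · rw [Finsupp.sum_smul_index (by simp), ← Finsupp.mul_sum, f2, mul_zero]
      · intro i
        rw [Finsupp.sum_smul_index (by simp)]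
        simp only [mul_smul]
        rw [← Finsupp.smul_sum, f3]; rfl
  let Dc := D.topologicalClosure
  have hDc : IsClosed (Dc : Set Y) := D.isClosed_topologicalClosure
  haveI : CompleteSpace Dc := hDc.completeSpace_coe
  -- invariance of D under H
  have hDinv : ∀ h ∈ H, ∀ y ∈ D, R h y ∈ D := by
    intro h hh y hy
    induction hy using Submodule.span_induction with
    | mem y hy =>
      obtain ⟨h', hh', rfl⟩ := hy
      have : R h (R h' B - B) = (R (h * h') B - B) - (R h B - B) := by
        ext i
        change ρ h (ρ h' (b i) - b i) = (ρ (h * h') (b i) - b i) - (ρ h (b i) - b i)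
        rw [map_sub, aux_mul]; abel
      rw [this]
      exact D.sub_mem (Submodule.subset_span ⟨_, H.mul_mem hh hh', rfl⟩)
        (Submodule.subset_span ⟨_, hh, rfl⟩)
    | zero => simp
    | add x y _ _ hx hy => rw [map_add]; exact D.add_mem hx hy
    | smul c x _ hx => rw [map_smul]; exact D.smul_mem c hx
  have hDcinv : ∀ h ∈ H, ∀ y ∈ Dc, R h y ∈ Dc := by
    intro h hh y hy
    exact map_mem_closure (R h).continuous hy (fun z hz => hDinv h hh z hz)
  set r : Y := B - Dc.starProjection B with hr
  have hrD : r ∈ Dcᗮ := Dc.sub_starProjection_mem_orthogonal B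
  have hrfix : ∀ h ∈ H, R h r = r := by
    intro h hh
    have hd : R h r - r ∈ Dc := by
      have : R h r - r = (R h B - B) - R h (Dc.starProjection B) + Dc.starProjection B := by
        rw [hr, map_sub]; abel
      rw [this]
      refine Dc.add_mem (Dc.sub_mem ?_ (hDcinv h hh _ (Dc.starProjection_apply_mem B)))
        (Dc.starProjection_apply_mem B)
      exact D.le_topologicalClosure (Submodule.subset_span ⟨_, hh, rfl⟩)
    have ho : inner ℂ r (R h r - r) = 0 := by
      rw [inner_eq_zero_symm]; exact hrD _ hd
    have hn : ‖r + (R h r - r)‖ ^ 2 = ‖r‖ ^ 2 + ‖R h r - r‖ ^ 2 := by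
      have := norm_add_sq_eq_norm_sq_add_norm_sq_of_inner_eq_zero (𝕜 := ℂ) r (R h r - r) ho
      nlinarith
    rw [add_sub_cancel, hRn] at hn
    have : ‖R h r - r‖ = 0 := by
      have : ‖R h r - r‖ ^ 2 = 0 := by linarith
      exact pow_eq_zero_iff two_ne_zero |>.1 this
    exact sub_eq_zero.1 (norm_eq_zero.1 this)
  have hrperp : ∀ i, r i ∈ (auxFix ρ H)ᗮ := by
    have hcl : IsClosed {y : Y | ∀ i, y i ∈ (auxFix ρ H)ᗮ} := by
      have : {y : Y | ∀ i, y i ∈ (auxFix ρ H)ᗮ} = ⋂ i, {y : Y | y i ∈ (auxFix ρ H)ᗮ} := by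
        ext y; simp
      rw [this]
      exact isClosed_iInter fun i => (Submodule.isClosed_orthogonal _).preimage
        (PiLp.continuous_apply 2 _ i)
    have hD' : (D : Set Y) ⊆ {y : Y | ∀ i, y i ∈ (auxFix ρ H)ᗮ} := by
      intro y hy
      obtain ⟨f, f1, f2, f3⟩ := hDT y hy
      intro i
      rw [← f3 i]
      refine Submodule.sum_mem _ fun g hg => Submodule.smul_mem _ _ ?_
      intro x hx
      rw [aux_adj', hx _ (H.inv_mem (f1 g hg))]
      exact hb i x hx
    have := closure_minimal hD' hcl (Dc.starProjection_apply_mem B)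
    intro i
    exact Submodule.sub_mem _ (hb i) (this i)
  have hr0 : r = 0 := by
    ext i
    have : r i ∈ auxFix ρ H := by
      intro h hh
      rw [← hR, hrfix h hh]
    exact inner_self_eq_zero.1 (hrperp i _ this)
  have hBD : B ∈ closure (D : Set Y) := by
    have : B = Dc.starProjection B := sub_eq_zero.1 hr0
    rw [this]
    exact Dc.starProjection_apply_mem B
  obtain ⟨y, hy, hyd⟩ := Metric.mem_closure_iff.1 hBD η hη
  obtain ⟨f, f1, f2, f3⟩ := hDT y hy
  refine ⟨f, f1, f2, fun i => ?_⟩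
  rw [f3, ← hB, norm_sub_rev]
  rw [dist_eq_norm] at hyd
  exact (PiLp.norm_apply_le (B - y) i).trans_lt hyd

/-- The dual inner product. -/
noncomputable def auxDualInner (W : Type*) [NormedAddCommGroup W] [InnerProductSpace ℂ W]
    [CompleteSpace W] : InnerProductSpace ℂ (StrongDual ℂ W) where
  inner a b := inner ℂ ((InnerProductSpace.toDual ℂ W).symm b) ((InnerProductSpace.toDual ℂ W).symm a)
  norm_sq_eq_re_inner a := by
    change ‖a‖ ^ 2 = RCLike.re (inner ℂ ((InnerProductSpace.toDual ℂ W).symm a)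
      ((InnerProductSpace.toDual ℂ W).symm a))
    rw [inner_self_eq_norm_sq, LinearIsometryEquiv.norm_map]
  conj_inner_symm a b := inner_conj_symm _ _
  add_left a b c := by
    rw [map_add, inner_add_right]
  smul_left a b c := by
    rw [LinearIsometryEquiv.map_smulₛₗ, inner_smul_right]

open TensorProduct in
theorem aux_tensor0 {G : Type u} [Group G]
    {W : Type u} [NormedAddCommGroup W] [InnerProductSpace ℂ W] [CompleteSpace W]
    (ρ : G →* (W ≃ₗᵢ[ℂ] W))
    {D : Type u} [NormedAddCommGroup D] [InnerProductSpace ℂ D] (τ : W ≃ₗᵢ⋆[ℂ] D)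
    (hτ : ∀ x y, inner ℂ (τ x) (τ y) = inner ℂ y x) :
    ∃ (Y : Type u) (_ : NormedAddCommGroup Y) (_ : InnerProductSpace ℂ Y) (_ : CompleteSpace Y)
      (π : G →* (Y ≃ₗᵢ[ℂ] Y)) (q : W →ₗ⋆[ℂ] W →ₗ[ℂ] Y),
      (∀ y x y' x', inner ℂ (q y x) (q y' x') = inner ℂ x x' * inner ℂ y' y) ∧
      (∀ g y x, π g (q y x) = q (ρ g y) (ρ g x)) ∧
      (∀ g, (∀ y x, q (ρ g y) (ρ g x) = q y x) → ∀ z, π g z = z) := by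
  let δ : G → (D ≃ₗᵢ[ℂ] D) := fun g =>
    (τ.symm.trans (ρ g)).trans τ
  have hδ : ∀ g y, δ g (τ y) = τ (ρ g y) := by
    intro g y
    simp [δ]
  have hδm : ∀ g h a, δ (g * h) a = δ g (δ h a) := by
    intro g h a
    obtain ⟨y, rfl⟩ := τ.surjective a
    rw [hδ, hδ, hδ, aux_mul]
  let E := W ⊗[ℂ] D
  let α : G → (E ≃ₗᵢ[ℂ] E) := fun g => TensorProduct.congrIsometry (ρ g) (δ g)
  have hα : ∀ g x a, α g (x ⊗ₜ a) = (ρ g x) ⊗ₜ (δ g a) := fun g x a => rfl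
  let Y := UniformSpace.Completion E
  let e : E →L[ℂ] Y := UniformSpace.Completion.toComplL
  have he : DenseRange e := UniformSpace.Completion.denseRange_coe
  have hen : ∀ x, ‖e x‖ = ‖x‖ := fun x => UniformSpace.Completion.norm_coe x
  have hei : ∀ x y, inner ℂ (e x) (e y) = inner ℂ x y := fun x y =>
    UniformSpace.Completion.inner_coe x y
  obtain ⟨π, hπ⟩ := aux_rep_extend (G := G) e.toLinearMap he (fun g => (α g).toLinearEquiv)
    (by
      intro g h x
      change α (g * h) x = α g (α h x)
      induction x using TensorProduct.induction_on with
      | zero => simp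
      | add x y hx hy => simp only [map_add, hx, hy]
      | tmul x a => rw [hα, hα, hα, hδm, aux_mul])
    (by
      intro g x
      change ‖e (α g x)‖ = ‖e x‖
      rw [hen, hen, LinearIsometryEquiv.norm_map])
  have hπ' : ∀ g x, π g (e x) = e (α g x) := hπ
  let q : W →ₗ⋆[ℂ] W →ₗ[ℂ] Y := LinearMap.mk₂'ₛₗ (starRingEnd ℂ) (RingHom.id ℂ)
    (fun y x => e (x ⊗ₜ τ y))
    (by intro a b c; rw [map_add, TensorProduct.tmul_add, map_add])
    (by intro c a b; rw [LinearIsometryEquiv.map_smulₛₗ, TensorProduct.tmul_smul, map_smul])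
    (by intro a b c; rw [TensorProduct.add_tmul, map_add])
    (by intro c a b; rw [← TensorProduct.smul_tmul', map_smul]; rfl)
  have hq : ∀ y x, q y x = e (x ⊗ₜ τ y) := fun y x => rfl
  have hπq : ∀ g y x, π g (q y x) = q (ρ g y) (ρ g x) := by
    intro g y x
    rw [hq, hq, hπ', hα, hδ]
  refine ⟨Y, inferInstance, inferInstance, inferInstance, π, q, ?_, hπq, ?_⟩
  · intro y x y' x'
    rw [hq, hq, hei, TensorProduct.inner_tmul]
    rw [hτ]
  · intro g hg z
    refine he.induction_on (p := fun z => π g z = z) z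
      (isClosed_eq (π g).continuous continuous_id) ?_
    intro x
    induction x using TensorProduct.induction_on with
    | zero => simp
    | add x y hx hy => simp only [map_add, hx, hy]
    | tmul x a =>
      obtain ⟨y, rfl⟩ := τ.surjective a
      rw [← hq, hπq, hg]

theorem aux_tensor {G : Type u} [Group G]
    {W : Type u} [NormedAddCommGroup W] [InnerProductSpace ℂ W] [CompleteSpace W]
    (ρ : G →* (W ≃ₗᵢ[ℂ] W)) :
    ∃ (Y : Type u) (_ : NormedAddCommGroup Y) (_ : InnerProductSpace ℂ Y) (_ : CompleteSpace Y)
      (π : G →* (Y ≃ₗᵢ[ℂ] Y)) (q : W →ₗ⋆[ℂ] W →ₗ[ℂ] Y),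
      (∀ y x y' x', inner ℂ (q y x) (q y' x') = inner ℂ x x' * inner ℂ y' y) ∧
      (∀ g y x, π g (q y x) = q (ρ g y) (ρ g x)) ∧
      (∀ g, (∀ y x, q (ρ g y) (ρ g x) = q y x) → ∀ z, π g z = z) := by
  letI : InnerProductSpace ℂ (StrongDual ℂ W) := auxDualInner W
  refine aux_tensor0 ρ (InnerProductSpace.toDual ℂ W) ?_
  intro x y
  change inner ℂ ((InnerProductSpace.toDual ℂ W).symm (InnerProductSpace.toDual ℂ W y))
    ((InnerProductSpace.toDual ℂ W).symm (InnerProductSpace.toDual ℂ W x)) = _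
  simp

/-- invariant vectors in the tensor product have small overlap -/
theorem aux_tensor_inv {G : Type u} [Group G]
    {W : Type u} [NormedAddCommGroup W] [InnerProductSpace ℂ W] [CompleteSpace W]
    (ρ : G →* (W ≃ₗᵢ[ℂ] W))
    (hcomm : ∀ A : W →L[ℂ] W, (∀ g x, A (ρ g x) = ρ g (A x)) → ∃ c : ℂ, ∀ x, A x = c • x)
    (m : ℕ) (hm : 1 ≤ m) (hrank : (m : Cardinal) ≤ Module.rank ℂ W)
    {Y : Type u} [NormedAddCommGroup Y] [InnerProductSpace ℂ Y] [CompleteSpace Y]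
    (π : G →* (Y ≃ₗᵢ[ℂ] Y)) (q : W →ₗ⋆[ℂ] W →ₗ[ℂ] Y)
    (hq : ∀ y x y' x', inner ℂ (q y x) (q y' x') = inner ℂ x x' * inner ℂ y' y)
    (hπ : ∀ g y x, π g (q y x) = q (ρ g y) (ρ g x)) (u : W) :
    ‖(auxFix π ⊤).starProjection (q u u)‖ ^ 2 ≤ ‖u‖ ^ 4 / m := by
  have hqn : ∀ y x, ‖q y x‖ = ‖y‖ * ‖x‖ := by
    intro y x
    have h1 : ‖q y x‖ ^ 2 = (‖y‖ * ‖x‖) ^ 2 := by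
      have := hq y x y x
      rw [aux_inner_self, aux_inner_self, aux_inner_self] at this
      have h2 : ‖q y x‖ ^ 2 = ‖x‖ ^ 2 * ‖y‖ ^ 2 := by exact_mod_cast this
      rw [h2]; ring
    exact (sq_eq_sq₀ (norm_nonneg _) (by positivity)).1 h1
  set z := (auxFix π ⊤).starProjection (q u u) with hz
  have hzfix : ∀ g, π g z = z := fun g => (Submodule.starProjection_apply_mem _ _ : z ∈ auxFix π ⊤) g trivial
  -- the operator
  let F : W →ₗ⋆[ℂ] W →ₗ[ℂ] ℂ := LinearMap.mk₂'ₛₗ (starRingEnd ℂ) (RingHom.id ℂ)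
    (fun y x => inner ℂ z (q y x))
    (by intro a b c; rw [map_add, LinearMap.add_apply, inner_add_right])
    (by intro c a b; rw [LinearMap.map_smulₛₗ, LinearMap.smul_apply, inner_smul_right]; rfl)
    (by intro a b c; rw [map_add, inner_add_right])
    (by intro c a b; rw [map_smul, inner_smul_right]; rfl)
  have hF : ∀ y x, F y x = inner ℂ z (q y x) := fun y x => rfl
  let F' := F.mkContinuous₂ ‖z‖ (by
    intro y x
    rw [hF, mul_assoc, ← hqn]
    exact norm_inner_le_norm _ _)
  let B := InnerProductSpace.continuousLinearMapOfBilin F'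
  have hB : ∀ y x, inner ℂ (B y) x = inner ℂ z (q y x) := by
    intro y x
    rw [InnerProductSpace.continuousLinearMapOfBilin_apply]
    rfl
  obtain ⟨c, hc⟩ := hcomm B (by
    intro g y
    refine ext_inner_right ℂ fun x => ?_
    rw [aux_adj, hB, hB, ← (π g).inner_map_map z (q y _), hzfix, hπ, aux_inv])
  have hzq : ∀ y x, inner ℂ z (q y x) = starRingEnd ℂ c * inner ℂ y x := by
    intro y x
    rw [← hB, hc, inner_smul_left]
  have hzz : ((‖z‖ ^ 2 : ℝ) : ℂ) = starRingEnd ℂ c * ((‖u‖ ^ 2 : ℝ) : ℂ) := by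
    rw [← aux_inner_self, ← aux_inner_self, ← hzq]
    conv_lhs => rw [hz]
    rw [← Submodule.inner_starProjection_left_eq_right]
    conv_rhs => rw [hz]
    rw [Submodule.starProjection_eq_self_iff.2 (Submodule.starProjection_apply_mem _ _)]
  have hzz' : ‖z‖ ^ 2 = ‖c‖ * ‖u‖ ^ 2 := by
    have := congrArg norm hzz
    rw [norm_mul, Complex.norm_real, Complex.norm_real, RCLike.norm_conj] at this
    simpa using this
  -- orthonormal family
  obtain ⟨s, hs, hli⟩ := le_rank_iff_exists_linearIndependent_finset.1 hrank
  obtain ⟨e, he⟩ : ∃ e : Fin m → W, Orthonormal ℂ e := by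
    have hli2 : LinearIndependent ℂ (fun i : Fin m => ((s.equivFinOfCardEq hs).symm i : W)) :=
      hli.comp _ (s.equivFinOfCardEq hs).symm.injective
    exact ⟨_, InnerProductSpace.gramSchmidtNormed_orthonormal hli2⟩
  have hm0 : (0 : ℝ) < m := by exact_mod_cast hm
  have hcz : m * ‖c‖ ^ 2 ≤ ‖z‖ ^ 2 := by
    set Q := ∑ i, q (e i) (e i) with hQ
    have h1 : inner ℂ z Q = starRingEnd ℂ c * m := by
      rw [hQ, inner_sum]
      have : ∀ i, inner ℂ z (q (e i) (e i)) = starRingEnd ℂ c := by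
        intro i
        rw [hzq, aux_inner_self, he.1 i]; simp
      simp only [this]
      simp [mul_comm]
    have h2 : ‖Q‖ ^ 2 = m := by
      rw [← Complex.ofReal_inj, ← aux_inner_self, hQ, sum_inner]
      simp only [inner_sum, hq, orthonormal_iff_ite.1 he]
      simp
    have h3 : ‖c‖ * m ≤ ‖z‖ * ‖Q‖ := by
      have := norm_inner_le_norm (𝕜 := ℂ) z Q
      rw [h1, norm_mul, RCLike.norm_conj] at this
      simpa using this
    have h4 : (‖c‖ * m) ^ 2 ≤ ‖z‖ ^ 2 * m := by
      calc (‖c‖ * m) ^ 2 ≤ (‖z‖ * ‖Q‖) ^ 2 := by gcongr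
        _ = _ := by rw [mul_pow, h2]
    have h5 : m * (m * ‖c‖ ^ 2) ≤ m * ‖z‖ ^ 2 := by nlinarith
    exact le_of_mul_le_mul_left h5 hm0
  -- conclude
  rw [le_div_iff₀ hm0]
  rcases eq_or_ne ‖z‖ 0 with h0 | h0
  · rw [h0]; simp
  · have hz2 : 0 < ‖z‖ ^ 2 := by positivity
    have : ‖z‖ ^ 2 * (‖z‖ ^ 2 * m) ≤ ‖z‖ ^ 2 * ‖u‖ ^ 4 := by
      calc ‖z‖ ^ 2 * (‖z‖ ^ 2 * m) = (m * ‖c‖ ^ 2) * ‖u‖ ^ 4 := by rw [hzz']; ring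
        _ ≤ _ := by gcongr
    exact le_of_mul_le_mul_left this hz2

theorem aux_L5 {G : Type u} [Group G] {k : ℕ} {X : Fin k → Subgroup G} {H : Subgroup G}
    {ε : ℝ} (hε0 : 0 ≤ ε) (hquot : auxQuot X H ε)
    {W : Type u} [NormedAddCommGroup W] [InnerProductSpace ℂ W] [CompleteSpace W]
    (ρ : G →* (W ≃ₗᵢ[ℂ] W))
    (hcomm : ∀ A : W →L[ℂ] W, (∀ g x, A (ρ g x) = ρ g (A x)) → ∃ c : ℂ, ∀ x, A x = c • x)
    (hscal : ∀ h ∈ H, ∃ c : ℂ, ∀ x, ρ h x = c • x)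
    (m : ℕ) (hm : 1 ≤ m) (hrank : (m : Cardinal) ≤ Module.rank ℂ W)
    (u : Fin k → W) (hu : ∀ i, ∀ g ∈ X i, ρ g (u i) = u i) :
    ‖∑ i, u i‖ ^ 2 ≤ (1 - ((m : ℝ) - 1) * ε / (2 * m)) * k * ∑ i, ‖u i‖ ^ 2 := by
  have hm0 : (0 : ℝ) < m := by exact_mod_cast hm
  obtain ⟨Y, _, _, _, π, q, hq, hπ, htriv⟩ := aux_tensor ρ
  have hH : ∀ h ∈ H, ∀ w, π h w = w := by
    intro h hh
    refine htriv h fun y x => ?_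
    obtain ⟨c, hc⟩ := hscal h hh
    have hn : Nontrivial W := by
      by_contra hn
      rw [not_nontrivial_iff_subsingleton] at hn
      rw [rank_subsingleton' ] at hrank
      have : m ≤ 0 := by exact_mod_cast hrank
      omega
    obtain ⟨x0, hx0⟩ := exists_ne (0 : W)
    have hc1 : ‖c‖ = 1 := by
      have := (ρ h).norm_map x0
      rw [hc, norm_smul] at this
      exact mul_right_cancel₀ (norm_ne_zero_iff.2 hx0) (by rw [this, one_mul])
    rw [hc, hc, map_smul, LinearMap.map_smulₛₗ, LinearMap.smul_apply, smul_smul, Complex.mul_conj,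
      Complex.normSq_eq_norm_sq, hc1]
    simp
  let p : Fin k → Y := fun i => (((‖u i‖⁻¹ : ℝ)) : ℂ) • q (u i) (u i)
  have hpX : ∀ i, ∀ g ∈ X i, π g (p i) = p i := by
    intro i g hg
    simp only [p]
    rw [map_smul, hπ, hu i g hg]
  have L6 := aux_L6 hquot π hH p hpX
  have hqn : ∀ x, ‖q x x‖ = ‖x‖ ^ 2 := by
    intro x
    have h1 : ‖q x x‖ ^ 2 = (‖x‖ ^ 2) ^ 2 := by
      have := hq x x x x
      rw [aux_inner_self, aux_inner_self] at this
      have h2 : ‖q x x‖ ^ 2 = ‖x‖ ^ 2 * ‖x‖ ^ 2 := by exact_mod_cast this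
      rw [h2]; ring
    exact (sq_eq_sq₀ (norm_nonneg _) (by positivity)).1 h1
  have hpn : ∀ i, ‖p i‖ ^ 2 = ‖u i‖ ^ 2 := by
    intro i
    simp only [p]
    rw [norm_smul, hqn, Complex.norm_real, norm_inv, norm_norm]
    rcases eq_or_ne ‖u i‖ 0 with h0 | h0
    · simp [h0]
    · field_simp
  have hP : ∀ i, ‖(auxFix π ⊤).starProjection (p i)‖ ^ 2 ≤ ‖u i‖ ^ 2 / m := by
    intro i
    have := aux_tensor_inv ρ hcomm m hm hrank π q hq hπ (u i)
    simp only [p]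
    rw [map_smul, norm_smul, mul_pow, Complex.norm_real, norm_inv, norm_norm]
    rcases eq_or_ne ‖u i‖ 0 with h0 | h0
    · simp [h0]
    · calc _ ≤ (‖u i‖⁻¹) ^ 2 * (‖u i‖ ^ 4 / m) := by gcongr
        _ = _ := by field_simp
  set S := ∑ i, ‖u i‖ ^ 2 with hS
  have hS0 : 0 ≤ S := Finset.sum_nonneg fun i _ => by positivity
  have h6 : ‖∑ i, p i‖ ^ 2 ≤ (1 - ε) * k * S + ε * k * (S / m) := by
    refine L6.trans ?_
    have e1 : ∑ i, ‖p i‖ ^ 2 = S := Finset.sum_congr rfl fun i _ => hpn i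
    rw [e1]
    gcongr
    rw [hS, Finset.sum_div]
    exact Finset.sum_le_sum fun i _ => hP i
  have hexp : ‖∑ i, p i‖ ^ 2 = ∑ i, ∑ j, ‖u i‖⁻¹ * ‖u j‖⁻¹ * ‖inner ℂ (u i) (u j)‖ ^ 2 := by
    rw [← Complex.ofReal_inj, ← aux_inner_self, aux_inner_sum]
    simp only [Complex.ofReal_sum]
    refine Finset.sum_congr rfl fun i _ => Finset.sum_congr rfl fun j _ => ?_
    rw [hq, ← inner_conj_symm (u j) (u i), Complex.mul_conj, Complex.normSq_eq_norm_sq,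
      Complex.conj_ofReal]
    push_cast
    ring
  have hterm : ∀ i j, ‖inner ℂ (u i) (u j)‖ ≤
      (‖u i‖⁻¹ * ‖u j‖⁻¹ * ‖inner ℂ (u i) (u j)‖ ^ 2 + ‖u i‖ * ‖u j‖) / 2 := by
    intro i j
    rcases eq_or_ne (u i) 0 with h0 | h0
    · simp [h0]
    rcases eq_or_ne (u j) 0 with h1 | h1
    · simp [h1]
    have a0 : 0 < ‖u i‖ := norm_pos_iff.2 h0
    have b0 : 0 < ‖u j‖ := norm_pos_iff.2 h1
    set t := ‖inner ℂ (u i) (u j)‖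
    set a := ‖u i‖
    set b := ‖u j‖
    have : (a⁻¹ * b⁻¹ * t ^ 2 + a * b) / 2 - t = a⁻¹ * b⁻¹ * (t - a * b) ^ 2 / 2 := by
      field_simp; ring
    have : 0 ≤ a⁻¹ * b⁻¹ * (t - a * b) ^ 2 / 2 := by positivity
    linarith
  have hmain : ‖∑ i, u i‖ ^ 2 ≤ (‖∑ i, p i‖ ^ 2 + (∑ i, ‖u i‖) ^ 2) / 2 := by
    have h1 : ‖∑ i, u i‖ ^ 2 ≤ ∑ i, ∑ j, ‖inner ℂ (u i) (u j)‖ := by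
      have : ((‖∑ i, u i‖ ^ 2 : ℝ) : ℂ) = ∑ i, ∑ j, inner ℂ (u i) (u j) := by
        rw [← aux_inner_self, sum_inner]
        simp only [inner_sum]
      have h2 := congrArg norm this
      rw [Complex.norm_real, Real.norm_of_nonneg (by positivity)] at h2
      rw [h2]
      refine (norm_sum_le _ _).trans (Finset.sum_le_sum fun i _ => norm_sum_le _ _)
    refine h1.trans ((Finset.sum_le_sum fun i _ => Finset.sum_le_sum fun j _ => hterm i j).trans ?_)
    rw [hexp, sq (∑ i, ‖u i‖), Finset.sum_mul_sum]
    simp only [← Finset.sum_div, Finset.sum_add_distrib]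
    exact le_rfl
  have hcs : (∑ i, ‖u i‖) ^ 2 ≤ k * S := by
    have := sq_sum_le_card_mul_sum_sq (s := (Finset.univ : Finset (Fin k))) (f := fun i => ‖u i‖)
    simpa using this
  have : (1 - ((m : ℝ) - 1) * ε / (2 * m)) * k * S =
      ((1 - ε) * k * S + ε * k * (S / m) + k * S) / 2 := by
    field_simp; ring
  rw [this]
  linarith

theorem aux_irr {G : Type u} [Group G] {k : ℕ} {X : Fin k → Subgroup G} {H : Subgroup G}
    (hHcentral : H ≤ Subgroup.center G) (m : ℕ) (hm : 1 ≤ m)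
    (hdim : ∀ (W : Type u) [NormedAddCommGroup W] [InnerProductSpace ℂ W] [CompleteSpace W],
      ∀ ρ : G →* (W ≃ₗᵢ[ℂ] W),
        Nontrivial W →
        (∀ K : Submodule ℂ W, IsClosed (K : Set W) →
          (∀ g : G, ∀ w ∈ K, ρ g w ∈ K) → K = ⊥ ∨ K = ⊤) →
        (∃ h ∈ H, ∃ w : W, ρ h w ≠ w) →
        (m : Cardinal) ≤ Module.rank ℂ W)
    {ε : ℝ} (hε0 : 0 ≤ ε) (hquot : auxQuot X H ε)
    {V : Type u} [NormedAddCommGroup V] [InnerProductSpace ℂ V] [CompleteSpace V]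
    (ρ : G →* (V ≃ₗᵢ[ℂ] V))
    (v : Fin k → V) (hv : ∀ i, ∀ g ∈ X i, ρ g (v i) = v i)
    (f : G →₀ ℂ) (hf : ∀ g ∈ f.support, g ∈ H) (hf0 : (f.sum fun _ a => a) = 0) :
    ‖∑ i, f.sum fun g a => a • ρ g (v i)‖ ^ 2 ≤
      (1 - ((m : ℝ) - 1) * ε / (2 * m)) * k * ∑ i, ‖f.sum fun g a => a • ρ g (v i)‖ ^ 2 := by
  by_contra hlt
  rw [not_le] at hlt
  obtain ⟨W, _, _, _, ρ', w, hw, hlt', hcomm⟩ := aux_extreme X f _ V ρ v hv hlt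
  have hscal : ∀ h ∈ H, ∃ c : ℂ, ∀ x, ρ' h x = c • x := by
    intro h hh
    refine hcomm (ρ' h).toContinuousLinearEquiv.toContinuousLinearMap ?_
    intro g x
    change ρ' h (ρ' g x) = ρ' g (ρ' h x)
    rw [← aux_mul, ← aux_mul, (Subgroup.mem_center_iff.1 (hHcentral hh) g)]
  have hnt : Nontrivial W := by
    by_contra hn
    rw [not_nontrivial_iff_subsingleton] at hn
    have : ∀ x : W, ‖x‖ = 0 := fun x => by rw [Subsingleton.elim x 0, norm_zero]
    simp [this] at hlt'
  have hHn : ∃ h ∈ H, ∃ w : W, ρ' h w ≠ w := by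
    by_contra hn
    push Not at hn
    have : ∀ i, (f.sum fun g a => a • ρ' g (w i)) = 0 := by
      intro i
      have e : (f.sum fun g a => a • ρ' g (w i)) = (f.sum fun _ a => a) • w i := by
        simp only [Finsupp.sum, Finset.sum_smul]
        exact Finset.sum_congr rfl fun g hg => by rw [hn g (hf g hg)]
      rw [e, hf0, zero_smul]
    simp [this] at hlt'
  have hirr : ∀ K : Submodule ℂ W, IsClosed (K : Set W) →
      (∀ g : G, ∀ w ∈ K, ρ' g w ∈ K) → K = ⊥ ∨ K = ⊤ := by
    intro K hKc hK
    haveI : CompleteSpace K := hKc.completeSpace_coe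
    obtain ⟨c, hc⟩ := hcomm K.starProjection (aux_proj_comm ρ' K hK)
    by_cases hc0 : c = 0
    · left
      rw [Submodule.eq_bot_iff]
      intro x hx
      rw [← Submodule.starProjection_eq_self_iff.2 hx, hc, hc0, zero_smul]
    · right
      rw [Submodule.eq_top_iff']
      intro x
      have : x = c⁻¹ • K.starProjection x := by rw [hc, inv_smul_smul₀ hc0]
      rw [this]
      exact K.smul_mem _ (K.starProjection_apply_mem x)
  have hrank := hdim W ρ' hnt hirr hHn
  have hTX : ∀ i, ∀ g ∈ X i, ρ' g (f.sum fun h a => a • ρ' h (w i)) =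
      (f.sum fun h a => a • ρ' h (w i)) := by
    intro i g hg
    simp only [Finsupp.sum, map_sum, map_smul]
    refine Finset.sum_congr rfl fun h hh => ?_
    rw [← aux_mul, (Subgroup.mem_center_iff.1 (hHcentral (hf h hh)) g), aux_mul, hw i g hg]
  exact absurd (aux_L5 hε0 hquot ρ' hcomm hscal m hm hrank
    (fun i => f.sum fun h a => a • ρ' h (w i)) hTX) (not_le.2 hlt')

/-- Theorem 9.8 (codistance step via central subgroups): `G` is a countable group
generated by subgroups `X₁, …, X_k`, `H ≤ Z(G)`, and `m ≥ 1` is such that every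
irreducible unitary representation of `G` on which `H` acts nontrivially has
Hilbert dimension at least `m`.  Representations of `G/H` are modelled as
unitary representations of `G` trivial on `H` (on such a representation the
fixed subspace of `Xᵢ` equals that of its image `X̄ᵢ` in `G/H`).  If
`codist(X̄₁, …, X̄_k) ≤ 1 - ε` with `0 ≤ ε ≤ 1`, then
`codist(X₁, …, X_k) ≤ 1 - (m-1)ε/(2m)`. -/
theorem statement16 {G : Type u} [Group G] [Countable G]
    (k : ℕ) (X : Fin k → Subgroup G) (hgen : (⨆ i, X i) = ⊤)
    (H : Subgroup G) (hHcentral : H ≤ Subgroup.center G)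
    (m : ℕ) (hm : 1 ≤ m)
    (hdim : ∀ (W : Type u) [NormedAddCommGroup W] [InnerProductSpace ℂ W] [CompleteSpace W],
      ∀ ρ : G →* (W ≃ₗᵢ[ℂ] W),
        Nontrivial W →
        (∀ K : Submodule ℂ W, IsClosed (K : Set W) →
          (∀ g : G, ∀ w ∈ K, ρ g w ∈ K) → K = ⊥ ∨ K = ⊤) →
        (∃ h ∈ H, ∃ w : W, ρ h w ≠ w) →
        (m : Cardinal) ≤ Module.rank ℂ W)
    (ε : ℝ) (hε0 : 0 ≤ ε) (hε1 : ε ≤ 1)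
    (hquot : ∀ (W : Type u) [NormedAddCommGroup W] [InnerProductSpace ℂ W] [CompleteSpace W],
      ∀ ρ : G →* (W ≃ₗᵢ[ℂ] W),
        (∀ h ∈ H, ∀ w : W, ρ h w = w) →
        (∀ w : W, (∀ g : G, ρ g w = w) → w = 0) →
        ∀ w : Fin k → W, (∀ i, ∀ g ∈ X i, ρ g (w i) = w i) →
        ‖∑ i, w i‖ ^ 2 ≤ (1 - ε) * k * ∑ i, ‖w i‖ ^ 2)
    (V : Type u) [NormedAddCommGroup V] [InnerProductSpace ℂ V] [CompleteSpace V]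
    (ρ : G →* (V ≃ₗᵢ[ℂ] V))
    (hnoinv : ∀ v : V, (∀ g : G, ρ g v = v) → v = 0)
    (v : Fin k → V) (hv : ∀ i, ∀ g ∈ X i, ρ g (v i) = v i) :
    ‖∑ i, v i‖ ^ 2 ≤ (1 - ((m : ℝ) - 1) * ε / (2 * m)) * k * ∑ i, ‖v i‖ ^ 2 := by
  have hquot' : auxQuot X H ε := hquot
  have hm0 : (0 : ℝ) < m := by exact_mod_cast hm
  set M := auxFix ρ H with hMdef
  have hHn : H.Normal := by
    constructor
    intro n hn g
    have := Subgroup.mem_center_iff.1 (hHcentral hn) g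
    rw [this, mul_inv_cancel_right]
    exact hn
  have hMinv : ∀ g, ∀ w ∈ M, ρ g w ∈ M := auxFix_inv ρ H hHn
  set c : ℝ := 1 - ((m : ℝ) - 1) * ε / (2 * m) with hc
  have hcle : 1 - ε ≤ c := by
    have : c - (1 - ε) = ε * (m + 1) / (2 * m) := by rw [hc]; field_simp; ring
    have : 0 ≤ ε * (m + 1) / (2 * m) := by positivity
    linarith
  have ha := aux_quot_restrict hquot' ρ M (auxFix_closed ρ H) hMinv (fun h hh w hw => hw h hh)
    (fun w _ hw => hnoinv w hw) (fun i => M.starProjection (v i))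
    (fun i => M.starProjection_apply_mem _)
    (fun i g hg => by rw [← aux_proj_comm ρ M hMinv, hv i g hg])
  have ha' : ‖∑ i, M.starProjection (v i)‖ ^ 2 ≤ c * k * ∑ i, ‖M.starProjection (v i)‖ ^ 2 := by
    refine ha.trans ?_
    gcongr
  set b : Fin k → V := fun i => Mᗮ.starProjection (v i) with hb
  have hbX : ∀ i, ∀ g ∈ X i, ρ g (b i) = b i := fun i g hg => by
    rw [hb]
    dsimp only
    rw [← aux_proj_comm ρ Mᗮ (aux_orth_inv ρ M hMinv), hv i g hg]
  have hb' : ‖∑ i, b i‖ ^ 2 ≤ c * k * ∑ i, ‖b i‖ ^ 2 := by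
    have hex := fun n : ℕ => aux_L8 ρ b (fun i => Submodule.starProjection_apply_mem _ _)
      (1 / ((n : ℝ) + 1)) (by positivity)
    choose f f1 f2 f3 using hex
    have ht : ∀ i, Filter.Tendsto (fun n => (f n).sum fun g a => a • ρ g (b i)) Filter.atTop
        (nhds (b i)) := by
      intro i
      rw [tendsto_iff_norm_sub_tendsto_zero]
      exact squeeze_zero (fun n => norm_nonneg _) (fun n => (f3 n i).le)
        tendsto_one_div_add_atTop_nhds_zero_nat
    refine le_of_tendsto_of_tendsto'
      (((tendsto_finsetSum _ fun i _ => ht i).norm).pow 2)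
      ((tendsto_finsetSum _ fun i _ => ((ht i).norm).pow 2).const_mul (c * k))
      (fun n => aux_irr hHcentral m hm hdim hε0 hquot' ρ b hbX (f n) (f1 n) (f2 n))
  have h3 := Submodule.norm_sq_eq_add_norm_sq_starProjection (∑ i, v i) M
  have h4 : ∑ i, ‖v i‖ ^ 2 = ∑ i, ‖M.starProjection (v i)‖ ^ 2 + ∑ i, ‖b i‖ ^ 2 := by
    rw [← Finset.sum_add_distrib]
    exact Finset.sum_congr rfl fun i _ => Submodule.norm_sq_eq_add_norm_sq_starProjection (v i) M
  rw [map_sum, map_sum] at h3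
  rw [h3, h4, mul_add]
  exact add_le_add ha' hb'
end

section
/- Let G be a group, H a subgroup of G, N a normal subgroup of H, Σ a subset of G, and a, b > 0 real numbers. Assume: (1) for every unitary representation V of G, every v ∈ V and every ε ≥ 0, if ‖sv − v‖ ≤ ε‖v‖ for all s ∈ Σ, then ‖nv − v‖ ≤ aε‖v‖ for all n ∈ N (i.e., κ_r(G, N; Σ) ≥ 1/a); (2) for every unitary representation W of H/N with no nonzero invariant vectors and every nonzero w ∈ W, there exists s ∈ Σ ∩ H whose image s̄ in H/N satisfies ‖s̄w − w‖ ≥ (1/b)‖w‖ (i.e., κ(H/N, image of Σ ∩ H) ≥ 1/b). Then for every unitary representation V of G, every v ∈ V and every ε ≥ 0, if ‖sv − v‖ ≤ ε‖v‖ for all s ∈ Σ, then ‖hv − v‖ ≤ √(2a² + 4b²)·ε‖v‖ for all h ∈ H (i.e., κ_r(G, H; Σ) ≥ 1/√(2a² + 4b²)). -/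
universe u

lemma le_of_sq_le_sq_aux {x y : ℝ} (h : x ^ 2 ≤ y ^ 2) (hy : 0 ≤ y) : x ≤ y :=
  le_of_abs_le (abs_le_of_sq_le_sq h hy)

section helpers
universe w
variable {G : Type w} [Group G] {V : Type w} [NormedAddCommGroup V] [InnerProductSpace ℂ V]

/-- The subspace of vectors fixed by `T`. -/
def fixedSub (ρ : G →* (V ≃ₗᵢ[ℂ] V)) (T : Subgroup G) : Submodule ℂ V where
  carrier := {v | ∀ t ∈ T, ρ t v = v}
  add_mem' := by
    intro x y hx hy t ht
    rw [map_add, hx t ht, hy t ht]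
  zero_mem' := by
    intro t _
    exact map_zero _
  smul_mem' := by
    intro c x hx t ht
    rw [map_smul, hx t ht]

lemma mem_fixedSub (ρ : G →* (V ≃ₗᵢ[ℂ] V)) (T : Subgroup G) (v : V) :
    v ∈ fixedSub ρ T ↔ ∀ t ∈ T, ρ t v = v := Iff.rfl

lemma isClosed_fixedSub (ρ : G →* (V ≃ₗᵢ[ℂ] V)) (T : Subgroup G) :
    IsClosed (fixedSub ρ T : Set V) := by
  have : (fixedSub ρ T : Set V) = ⋂ t ∈ T, {v | ρ t v = v} := by
    ext v
    simp [mem_fixedSub]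
  rw [this]
  exact isClosed_biInter fun t _ => isClosed_eq (ρ t).continuous continuous_id

lemma rho_mul (ρ : G →* (V ≃ₗᵢ[ℂ] V)) (g h : G) (v : V) : ρ (g * h) v = ρ g (ρ h v) := by
  rw [map_mul]; rfl

lemma rho_one (ρ : G →* (V ≃ₗᵢ[ℂ] V)) (v : V) : ρ 1 v = v := by
  rw [map_one]; rfl

lemma rho_inv_rho (ρ : G →* (V ≃ₗᵢ[ℂ] V)) (g : G) (v : V) : ρ g⁻¹ (ρ g v) = v := by
  rw [← rho_mul, inv_mul_cancel, rho_one]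

lemma rho_rho_inv (ρ : G →* (V ≃ₗᵢ[ℂ] V)) (g : G) (v : V) : ρ g (ρ g⁻¹ v) = v := by
  rw [← rho_mul, mul_inv_cancel, rho_one]

lemma rho_mem_fixed (ρ : G →* (V ≃ₗᵢ[ℂ] V)) (H N : Subgroup G)
    (hn : ∀ h ∈ H, ∀ n ∈ N, h * n * h⁻¹ ∈ N) {h : G} (hh : h ∈ H) {v : V}
    (hv : v ∈ fixedSub ρ N) : ρ h v ∈ fixedSub ρ N := by
  intro n hnN
  have h3 := hn h⁻¹ (H.inv_mem hh) n hnN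
  have h4 := hv _ h3
  rw [inv_inv, rho_mul, rho_mul] at h4
  rw [← rho_rho_inv ρ h (ρ n (ρ h v)), h4]

lemma rho_mem_orth (ρ : G →* (V ≃ₗᵢ[ℂ] V)) (H N : Subgroup G)
    (hn : ∀ h ∈ H, ∀ n ∈ N, h * n * h⁻¹ ∈ N) {h : G} (hh : h ∈ H) {v : V}
    (hv : v ∈ (fixedSub ρ N)ᗮ) : ρ h v ∈ (fixedSub ρ N)ᗮ := by
  rw [Submodule.mem_orthogonal] at hv ⊢
  intro u hu
  have := hv _ (rho_mem_fixed ρ H N hn (H.inv_mem hh) hu)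
  rw [← (ρ h).inner_map_map, rho_rho_inv] at this
  exact this

lemma conj_self (H : Subgroup G) : ∀ h ∈ H, ∀ n ∈ H, h * n * h⁻¹ ∈ H :=
  fun _ hh _ hn => H.mul_mem (H.mul_mem hh hn) (H.inv_mem hh)

lemma orbit_bound [CompleteSpace V] (ρ : G →* (V ≃ₗᵢ[ℂ] V)) (N : Subgroup G) (u : V)
    (hu : u ∈ (fixedSub ρ N)ᗮ) (c : ℝ) (hc : ∀ n ∈ N, c ≤ (inner ℂ (ρ n u) u).re) : c ≤ 0 := by
  letI : NormedSpace ℝ V := NormedSpace.restrictScalars ℝ ℂ V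
  letI : InnerProductSpace ℝ V := InnerProductSpace.rclikeToReal ℂ V
  set O : Set V := (fun n => ρ n u) '' (N : Set G) with hO
  set C : Set V := closure (convexHull ℝ O) with hC
  have hOC : O ⊆ C := (subset_convexHull ℝ O).trans subset_closure
  have hCconv : Convex ℝ C := (convex_convexHull ℝ O).closure
  have hCcl : IsClosed C := isClosed_closure
  have hCmin : ∀ D : Set V, O ⊆ D → Convex ℝ D → IsClosed D → C ⊆ D :=
    fun D h1 h2 h3 => closure_minimal (convexHull_min h1 h2) h3
  have hne : C.Nonempty := ⟨ρ 1 u, hOC ⟨1, N.one_mem, rfl⟩⟩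
  obtain ⟨x, hxC, hx⟩ := exists_norm_eq_iInf_of_complete_convex hne hCcl.isComplete hCconv 0
  have hmin : ∀ y ∈ C, ‖x‖ ≤ ‖y‖ := by
    intro y hy
    rw [zero_sub, norm_neg] at hx
    rw [hx]
    have := ciInf_le (f := fun w : C => ‖(0 : V) - w‖) ⟨0, by rintro _ ⟨z, rfl⟩; positivity⟩ ⟨y, hy⟩
    simpa using this
  have hinv : ∀ n ∈ N, ∀ y ∈ C, ρ n y ∈ C := by
    intro n hn
    refine hCmin ((fun y => ρ n y) ⁻¹' C) ?_ ?_ ?_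
    · rintro _ ⟨m, hm, rfl⟩
      refine hOC ⟨n * m, N.mul_mem hn hm, ?_⟩
      exact rho_mul ρ n m u
    · intro y hy z hz s t hs ht hst
      have := hCconv hy hz hs ht hst
      have e : ρ n (s • y + t • z) = s • ρ n y + t • ρ n z := by
        have k : ∀ (r : ℝ) (q : V), ρ n (r • q) = r • ρ n q := fun r q => (ρ n).map_smul (r : ℂ) q
        rw [map_add, k, k]
      show ρ n (s • y + t • z) ∈ C
      rw [e]; exact this
    · exact hCcl.preimage (ρ n).continuous
  have hxfix : x ∈ fixedSub ρ N := by
    intro n hn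
    have hmid := hCconv hxC (hinv n hn x hxC) (a := 1/2) (b := 1/2) (by norm_num) (by norm_num)
      (by norm_num)
    have h3 := hmin _ hmid
    rw [← smul_add, norm_smul] at h3
    have h4 := parallelogram_law_with_norm ℝ x (ρ n x)
    rw [(ρ n).norm_map] at h4
    norm_num at h3
    have h5 : ‖x - ρ n x‖ = 0 := by
      have := norm_nonneg x
      have := norm_nonneg (x - ρ n x)
      nlinarith
    exact (sub_eq_zero.1 (norm_eq_zero.1 h5)).symm
  have horth : C ⊆ ((fixedSub ρ N)ᗮ : Submodule ℂ V) := by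
    refine hCmin _ ?_ ?_ (Submodule.isClosed_orthogonal _)
    · rintro _ ⟨m, hm, rfl⟩
      exact rho_mem_orth ρ N N (conj_self N) hm hu
    · exact (((fixedSub ρ N)ᗮ).restrictScalars ℝ).convex
  have hx0 : x = 0 := by
    have := (Submodule.mem_orthogonal _ _).1 (horth hxC) x hxfix
    exact inner_self_eq_zero.1 this
  have hhalf : C ⊆ {y | c ≤ (inner ℂ y u).re} := by
    refine hCmin _ ?_ ?_ ?_
    · rintro _ ⟨m, hm, rfl⟩
      exact hc m hm
    · intro y hy z hz s t hs ht hst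
      have k : ∀ (r : ℝ) (q : V), (inner ℂ (r • q) u).re = r * (inner ℂ q u).re := by
        intro r q
        have : r • q = (r : ℂ) • q := rfl
        rw [this, inner_smul_left]; simp
      simp only [Set.mem_setOf_eq] at hy hz ⊢
      rw [inner_add_left, Complex.add_re, k, k]
      have : c = s * c + t * c := by rw [← add_mul, hst, one_mul]
      rw [this]; gcongr
    · exact isClosed_le continuous_const
        (Complex.continuous_re.comp (continuous_id.inner continuous_const))
  have := hhalf hxC
  rw [hx0] at this
  simpa using this

/-- Restriction of `ρ` to an `H`-invariant subspace. -/
def subRep (ρ : G →* (V ≃ₗᵢ[ℂ] V)) (H : Subgroup G) (W : Submodule ℂ V)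
    (hW : ∀ h ∈ H, ∀ x ∈ W, ρ h x ∈ W) : H →* (W ≃ₗᵢ[ℂ] W) where
  toFun h :=
    { toFun := fun x => ⟨ρ h x, hW h h.2 x x.2⟩
      invFun := fun x => ⟨ρ (h : G)⁻¹ x, hW _ (H.inv_mem h.2) x x.2⟩
      map_add' := fun x y => Subtype.ext (map_add (ρ (h : G)) (x : V) y)
      map_smul' := fun c x => Subtype.ext (map_smul (ρ (h : G)) c (x : V))
      left_inv := fun x => Subtype.ext (rho_inv_rho ρ h x)
      right_inv := fun x => Subtype.ext (rho_rho_inv ρ h x)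
      norm_map' := fun x => (ρ (h : G)).norm_map x }
  map_one' := by
    ext x
    exact rho_one ρ x
  map_mul' g h := by
    ext x
    exact rho_mul ρ g h x

lemma subRep_coe (ρ : G →* (V ≃ₗᵢ[ℂ] V)) (H : Subgroup G) (W : Submodule ℂ V)
    (hW : ∀ h ∈ H, ∀ x ∈ W, ρ h x ∈ W) (h : H) (x : W) :
    ((subRep ρ H W hW h x : W) : V) = ρ h x := rfl

end helpers

/-- Lemma 2.10 (supermultiplicativity of Kazhdan ratios): `G` a group, `H ≤ G`,
`N` a normal subgroup of `H`, `S ⊆ G`, `a, b > 0`.  Representations of `H/N` are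
modelled as unitary representations of the subgroup `H` trivial on `N`.
Hypotheses: (1) `κ_r(G, N; S) ≥ 1/a`; (2) `κ(H/N, image of S ∩ H) ≥ 1/b`.
Conclusion: `κ_r(G, H; S) ≥ 1/√(2a² + 4b²)`, i.e. every `(S, ε)`-invariant
vector of a unitary representation of `G` is `(H, √(2a² + 4b²)·ε)`-invariant. -/
theorem statement17 {G : Type u} [Group G]
    (H N : Subgroup G) (hNH : N ≤ H)
    (hNnorm : ∀ h ∈ H, ∀ n ∈ N, h * n * h⁻¹ ∈ N)
    (S : Set G) (a b : ℝ) (ha : 0 < a) (hb : 0 < b)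
    (h1 : ∀ (V : Type u) [NormedAddCommGroup V] [InnerProductSpace ℂ V] [CompleteSpace V],
      ∀ ρ : G →* (V ≃ₗᵢ[ℂ] V), ∀ v : V, ∀ ε : ℝ, 0 ≤ ε →
        (∀ s ∈ S, ‖ρ s v - v‖ ≤ ε * ‖v‖) → ∀ n ∈ N, ‖ρ n v - v‖ ≤ a * ε * ‖v‖)
    (h2 : ∀ (W : Type u) [NormedAddCommGroup W] [InnerProductSpace ℂ W] [CompleteSpace W],
      ∀ π : H →* (W ≃ₗᵢ[ℂ] W),
        (∀ n : H, (n : G) ∈ N → ∀ w : W, π n w = w) →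
        (∀ w : W, (∀ h : H, π h w = w) → w = 0) →
        ∀ w : W, w ≠ 0 → ∃ s : H, (s : G) ∈ S ∧ (1 / b) * ‖w‖ ≤ ‖π s w - w‖) :
    ∀ (V : Type u) [NormedAddCommGroup V] [InnerProductSpace ℂ V] [CompleteSpace V],
      ∀ ρ : G →* (V ≃ₗᵢ[ℂ] V), ∀ v : V, ∀ ε : ℝ, 0 ≤ ε →
        (∀ s ∈ S, ‖ρ s v - v‖ ≤ ε * ‖v‖) →
        ∀ h ∈ H, ‖ρ h v - v‖ ≤ Real.sqrt (2 * a ^ 2 + 4 * b ^ 2) * ε * ‖v‖ := by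
  intro V _ _ _ ρ v ε hε hS h hh
  have hHc := conj_self H
  haveI : CompleteSpace (fixedSub ρ N) := (isClosed_fixedSub ρ N).completeSpace_coe
  haveI : CompleteSpace (fixedSub ρ H) := (isClosed_fixedSub ρ H).completeSpace_coe
  have hle : fixedSub ρ H ≤ fixedSub ρ N := fun x hx n hn => hx n (hNH hn)
  obtain ⟨vN, hvN, u, hu, hvu⟩ := (fixedSub ρ N).exists_add_mem_mem_orthogonal v
  obtain ⟨vH, hvH, w, hw, hvw⟩ := (fixedSub ρ H).exists_add_mem_mem_orthogonal vN
  have hwN : w ∈ fixedSub ρ N := by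
    have : w = vN - vH := by rw [hvw]; abel
    rw [this]; exact sub_mem hvN (hle hvH)
  -- decomposition of the displacement
  have hdec : ∀ g ∈ H, ‖ρ g v - v‖ ^ 2 = ‖ρ g w - w‖ ^ 2 + ‖ρ g u - u‖ ^ 2 := by
    intro g hg
    have e : ρ g v - v = (ρ g w - w) + (ρ g u - u) := by
      rw [hvu, hvw, map_add, map_add, hvH g hg]; abel
    have o : inner ℂ (ρ g w - w) (ρ g u - u) = 0 :=
      (Submodule.mem_orthogonal _ _).1
        (sub_mem (rho_mem_orth ρ H N hNnorm hg hu) hu) _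
        (sub_mem (rho_mem_fixed ρ H N hNnorm hg hwN) hwN)
    rw [e, sq, sq, sq]
    exact norm_add_sq_eq_norm_sq_add_norm_sq_of_inner_eq_zero _ _ o
  have hεv : 0 ≤ ε * ‖v‖ := by positivity
  -- bound on `u`
  have hub : 2 * ‖u‖ ^ 2 ≤ (a * ε * ‖v‖) ^ 2 := by
    have := orbit_bound ρ N u hu (‖u‖ ^ 2 - (a * ε * ‖v‖) ^ 2 / 2) (by
      intro n hn
      have k1 := h1 V ρ v ε hε hS n hn
      have k2 := hdec n (hNH hn)
      rw [hwN n hn, sub_self, norm_zero] at k2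
      have k3 : ‖ρ n u - u‖ ^ 2 = ‖ρ n u‖ ^ 2 - 2 * (inner ℂ (ρ n u) u).re + ‖u‖ ^ 2 :=
        norm_sub_sq (𝕜 := ℂ) _ _
      rw [(ρ n).norm_map] at k3
      have k4 : ‖ρ n v - v‖ ^ 2 ≤ (a * ε * ‖v‖) ^ 2 := by gcongr
      nlinarith)
    linarith
  -- bound on `w`
  have hwb : ‖w‖ ≤ b * (ε * ‖v‖) := by
    by_cases hw0 : w = 0
    · rw [hw0, norm_zero]; positivity
    let W : Submodule ℂ V := fixedSub ρ N ⊓ (fixedSub ρ H)ᗮ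
    have hWcl : IsClosed (W : Set V) :=
      (isClosed_fixedSub ρ N).inter (Submodule.isClosed_orthogonal _)
    haveI : CompleteSpace W := hWcl.completeSpace_coe
    have hW : ∀ g ∈ H, ∀ x ∈ W, ρ g x ∈ W := fun g hg x hx =>
      ⟨rho_mem_fixed ρ H N hNnorm hg hx.1, rho_mem_orth ρ H H hHc hg hx.2⟩
    obtain ⟨s, hsS, hs⟩ := h2 W (subRep ρ H W hW)
      (fun n hn x => Subtype.ext (x.2.1 n hn))
      (fun x hx => by
        have hxH : (x : V) ∈ fixedSub ρ H := fun g hg => congrArg Subtype.val (hx ⟨g, hg⟩)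
        have := (Submodule.mem_orthogonal _ _).1 x.2.2 _ hxH
        exact Subtype.ext (inner_self_eq_zero.1 this))
      ⟨w, hwN, hw⟩ (fun h0 => hw0 (congrArg Subtype.val h0))
    have hs' : (1 / b) * ‖w‖ ≤ ‖ρ s w - w‖ := hs
    have k1 := hdec s s.2
    have k2 : ‖ρ s w - w‖ ≤ ‖ρ s v - v‖ := by
      apply le_of_sq_le_sq_aux _ (norm_nonneg _)
      nlinarith [sq_nonneg ‖ρ s u - u‖]
    have k3 := hs'.trans (k2.trans (hS s hsS))
    rw [one_div, inv_mul_le_iff₀ hb] at k3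
    exact k3
  have tri : ∀ x : V, ‖ρ h x - x‖ ^ 2 ≤ 4 * ‖x‖ ^ 2 := by
    intro x
    have := norm_sub_le (ρ h x) x
    rw [(ρ h).norm_map] at this
    nlinarith [norm_nonneg (ρ h x - x), norm_nonneg x]
  have hfin : ‖ρ h v - v‖ ^ 2 ≤ (Real.sqrt (2 * a ^ 2 + 4 * b ^ 2) * ε * ‖v‖) ^ 2 := by
    rw [hdec h hh, mul_pow, mul_pow, Real.sq_sqrt (by positivity)]
    have k1 := tri w
    have k2 := tri u
    have k3 : ‖w‖ ^ 2 ≤ (b * (ε * ‖v‖)) ^ 2 := by gcongr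
    nlinarith
  exact le_of_sq_le_sq_aux hfin (by positivity)
end
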